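/- arXiv:1304.6651 — 10 statements merged into one kernel-verified Lean document; each statement's English description precedes it below -/
import Mathlib

section
/- Let r > 0 be a real number and let λ₁, λ₂, λ₃ ∈ ℂ be nonzero complex numbers such that for each k: (λ_k² − r²)³ + λ_k² = 0 and λ_k² ≠ r², and such that λ₁λ₂λ₃ = r³ and (r² − λ₁²)(r² − λ₂²)(r² − λ₃²) = r². Then the determinant of the 3×3 complex matrix M with first row (1, 1, 1), second row (λ₁, λ₂, λ₃) and third row ((r² − λ₁²)²/λ₁, (r² − λ₂²)²/λ₂, (r² − λ₃²)²/λ₃) equals (λ₁ − λ₂)(λ₂ − λ₃)(λ₃ − λ₁)(r + λ₁ + λ₂ + λ₃). -/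
/-- Determinant of the boundary matrix of the Stokes-Coriolis system in the half-space. -/
theorem stmt0 (r : ℝ) (hr : 0 < r) (l1 l2 l3 : ℂ)
    (h1 : l1 ≠ 0) (h2 : l2 ≠ 0) (h3 : l3 ≠ 0)
    (he1 : (l1 ^ 2 - (r : ℂ) ^ 2) ^ 3 + l1 ^ 2 = 0)
    (he2 : (l2 ^ 2 - (r : ℂ) ^ 2) ^ 3 + l2 ^ 2 = 0)
    (he3 : (l3 ^ 2 - (r : ℂ) ^ 2) ^ 3 + l3 ^ 2 = 0)
    (hn1 : l1 ^ 2 ≠ (r : ℂ) ^ 2) (hn2 : l2 ^ 2 ≠ (r : ℂ) ^ 2) (hn3 : l3 ^ 2 ≠ (r : ℂ) ^ 2)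
    (hprod : l1 * l2 * l3 = (r : ℂ) ^ 3)
    (hprod2 : ((r : ℂ) ^ 2 - l1 ^ 2) * ((r : ℂ) ^ 2 - l2 ^ 2) * ((r : ℂ) ^ 2 - l3 ^ 2)
      = (r : ℂ) ^ 2) :
    Matrix.det !![1, 1, 1; l1, l2, l3;
        ((r : ℂ) ^ 2 - l1 ^ 2) ^ 2 / l1, ((r : ℂ) ^ 2 - l2 ^ 2) ^ 2 / l2,
        ((r : ℂ) ^ 2 - l3 ^ 2) ^ 2 / l3]
      = (l1 - l2) * (l2 - l3) * (l3 - l1) * ((r : ℂ) + l1 + l2 + l3) := by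
  have e1 : ((r : ℂ) ^ 2 - l1 ^ 2) ^ 2 / l1 = l1 ^ 3 - 2 * (r : ℂ) ^ 2 * l1 + r * l2 * l3 := by
    rw [div_eq_iff h1]
    linear_combination -(r : ℂ) * hprod
  have e2 : ((r : ℂ) ^ 2 - l2 ^ 2) ^ 2 / l2 = l2 ^ 3 - 2 * (r : ℂ) ^ 2 * l2 + r * l1 * l3 := by
    rw [div_eq_iff h2]
    linear_combination -(r : ℂ) * hprod
  have e3 : ((r : ℂ) ^ 2 - l3 ^ 2) ^ 2 / l3 = l3 ^ 3 - 2 * (r : ℂ) ^ 2 * l3 + r * l1 * l2 := by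
    rw [div_eq_iff h3]
    linear_combination -(r : ℂ) * hprod
  rw [e1, e2, e3, Matrix.det_fin_three]
  simp only [Matrix.of_apply, Matrix.cons_val]
  ring
end

section
/- For every real r > 0: (i) there is no t ∈ ℝ such that λ = it (purely imaginary) satisfies (λ² − r²)³ + λ² = 0 in ℂ; and (ii) there exists a unique real λ > 0 such that (λ² − r²)³ + λ² = 0. -/
/-- The real function `l ↦ (l² − r²)³ + l²` is strictly increasing on `[0, ∞)`. -/
lemma strictMonoOn_stokesCoriolis (r : ℝ) :
    StrictMonoOn (fun l : ℝ => (l ^ 2 - r ^ 2) ^ 3 + l ^ 2) (Set.Ici 0) := by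
  intro l hl m _ hlm
  have hsq : l ^ 2 < m ^ 2 := pow_lt_pow_left₀ hlm hl two_ne_zero
  have hcube : (l ^ 2 - r ^ 2) ^ 3 < (m ^ 2 - r ^ 2) ^ 3 :=
    Odd.strictMono_pow (by decide) (sub_lt_sub_right hsq _)
  exact add_lt_add hcube hsq

lemma exists_pos_root_stokesCoriolis {r : ℝ} (hr : 0 < r) :
    ∃ l : ℝ, 0 < l ∧ (l ^ 2 - r ^ 2) ^ 3 + l ^ 2 = 0 := by
  have hcont : ContinuousOn (fun l : ℝ => (l ^ 2 - r ^ 2) ^ 3 + l ^ 2) (Set.Icc 0 r) := by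
    fun_prop
  have h0 : ((0 : ℝ) ^ 2 - r ^ 2) ^ 3 + 0 ^ 2 < 0 := by
    have : 0 < r ^ 6 := by positivity
    linarith [show ((0 : ℝ) ^ 2 - r ^ 2) ^ 3 + 0 ^ 2 = -r ^ 6 by ring]
  have h1 : 0 < (r ^ 2 - r ^ 2) ^ 3 + r ^ 2 := by
    simpa using pow_pos hr 2
  obtain ⟨l, hl, hroot⟩ := intermediate_value_Ioo hr.le hcont ⟨h0, h1⟩
  exact ⟨l, hl.1, hroot⟩

/-- No purely imaginary root, and a unique positive real root, of the
Stokes-Coriolis characteristic equation `(λ² − r²)³ + λ² = 0` for `r > 0`. -/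
theorem stmt1 (r : ℝ) (hr : 0 < r) :
    (¬ ∃ t : ℝ, ((Complex.I * (t : ℂ)) ^ 2 - (r : ℂ) ^ 2) ^ 3 + (Complex.I * (t : ℂ)) ^ 2 = 0) ∧
    (∃! l : ℝ, 0 < l ∧ ((l : ℂ) ^ 2 - (r : ℂ) ^ 2) ^ 3 + (l : ℂ) ^ 2 = 0) := by
  constructor
  · rintro ⟨t, ht⟩
    rw [mul_pow, Complex.I_sq] at ht
    have hreal : (-1 * t ^ 2 - r ^ 2) ^ 3 + -1 * t ^ 2 = 0 := by exact_mod_cast ht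
    have hpos : 0 < (t ^ 2 + r ^ 2) ^ 3 + t ^ 2 := by positivity
    linarith [show (-1 * t ^ 2 - r ^ 2) ^ 3 + -1 * t ^ 2 = -((t ^ 2 + r ^ 2) ^ 3 + t ^ 2) by ring]
  · obtain ⟨l, hl, hroot⟩ := exists_pos_root_stokesCoriolis hr
    refine ⟨l, ⟨hl, by exact_mod_cast hroot⟩, ?_⟩
    rintro m ⟨hm, hm_root⟩
    have hm_real : (m ^ 2 - r ^ 2) ^ 3 + m ^ 2 = 0 := by exact_mod_cast hm_root
    exact (strictMonoOn_stokesCoriolis r).injOn hm.le hl.le (hm_real.trans hroot.symm)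
end

section
/- There exist constants C > 0 and R > 0 such that for all real r ≥ R: μ₁(r) > 0 and |√(μ₁(r)) − (r − (1/2) r^{−1/3})| ≤ C r^{−5/3}. In other words, the real eigenvalue λ₁(r) = √(μ₁(r)) of the Stokes–Coriolis characteristic equation satisfies λ₁(r) = r − (1/2) r^{−1/3} + O(r^{−5/3}) as r → ∞. -/
/-- `μ₁(r) = r² + a(r) − b(r)`, the square of the real Stokes-Coriolis eigenvalue. -/
noncomputable def mu1 (r : ℝ) : ℝ :=
  r ^ 2 + ((-r ^ 2 + Real.sqrt (r ^ 4 + 4 / 27)) / 2) ^ ((1 : ℝ) / 3)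
    - ((r ^ 2 + Real.sqrt (r ^ 4 + 4 / 27)) / 2) ^ ((1 : ℝ) / 3)

/-- For `r > 0` the number `r² − μ₁(r)` is a positive root of `x³ + x = r²` (Cardano's formula). -/
theorem exists_mu1_eq_sub_cardano_root {r : ℝ} (hr : 0 < r) :
    ∃ x : ℝ, 0 < x ∧ x ^ 3 + x = r ^ 2 ∧ mu1 r = r ^ 2 - x := by
  have cube_rpow : ∀ y : ℝ, 0 ≤ y → (y ^ ((1 : ℝ) / 3)) ^ 3 = y := fun y hy => by
    rw [← Real.rpow_natCast, ← Real.rpow_mul hy]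
    norm_num
  set D := Real.sqrt (r ^ 4 + 4 / 27) with hD
  have hD2 : D ^ 2 = r ^ 4 + 4 / 27 := Real.sq_sqrt (by positivity)
  have hDr : r ^ 2 < D := Real.lt_sqrt_of_sq_lt (by linarith [show (r ^ 2) ^ 2 = r ^ 4 by ring])
  have ha0 : 0 < (-r ^ 2 + D) / 2 := by linarith
  have hb0 : 0 < (r ^ 2 + D) / 2 := by positivity
  have hmu : mu1 r = r ^ 2 + ((-r ^ 2 + D) / 2) ^ ((1 : ℝ) / 3)
      - ((r ^ 2 + D) / 2) ^ ((1 : ℝ) / 3) := rfl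
  have ha3 := cube_rpow _ ha0.le
  have hb3 := cube_rpow _ hb0.le
  have ha := Real.rpow_pos_of_pos ha0 ((1 : ℝ) / 3)
  have hb := Real.rpow_pos_of_pos hb0 ((1 : ℝ) / 3)
  generalize ((-r ^ 2 + D) / 2) ^ ((1 : ℝ) / 3) = a at *
  generalize ((r ^ 2 + D) / 2) ^ ((1 : ℝ) / 3) = b at *
  have hab : a * b = 1 / 3 := by
    refine (pow_left_inj₀ (by positivity) (by norm_num) (by norm_num : 3 ≠ 0)).mp ?_
    rw [mul_pow, ha3, hb3]
    linear_combination hD2 / 4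
  have hx : (b - a) ^ 3 + (b - a) = r ^ 2 := by
    linear_combination hb3 - ha3 - 3 * (b - a) * hab
  refine ⟨b - a, ?_, hx, by rw [hmu]; ring⟩
  have hlt : a ^ 3 < b ^ 3 := by rw [ha3, hb3]; linarith [sq_pos_of_pos hr]
  linarith [lt_of_pow_lt_pow_left₀ 3 hb.le hlt]

/-- The positive root of `x³ + x = t⁶` lies within `t⁻²` below `t²`. -/
theorem cardano_root_bounds {t x : ℝ} (ht : 0 < t) (hx : 0 < x) (h : x ^ 3 + x = t ^ 6) :
    x < t ^ 2 ∧ t ^ 2 - x ≤ t⁻¹ ^ 2 := by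
  have hlt : x < t ^ 2 := lt_of_pow_lt_pow_left₀ 3 (by positivity)
    (by linarith [show (t ^ 2) ^ 3 = t ^ 6 by ring])
  refine ⟨hlt, ?_⟩
  rw [inv_pow, ← one_div, le_div_iff₀ (by positivity)]
  have hfac : (t ^ 2 - x) * (t ^ 4 + t ^ 2 * x + x ^ 2) = x := by linear_combination -h
  have hle : (t ^ 2 - x) * t ^ 4 ≤ x := by
    have : 0 ≤ t ^ 2 * x + x ^ 2 := by positivity
    exact (mul_le_mul_of_nonneg_left (by linarith) (by linarith)).trans_eq hfac
  refine le_of_mul_le_mul_right ?_ (show 0 < t ^ 2 by positivity)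
  linarith [show (t ^ 2 - x) * t ^ 2 * t ^ 2 = (t ^ 2 - x) * t ^ 4 by ring]

/-- High-frequency expansion `λ₁(r) = r − (1/2) r^{−1/3} + O(r^{−5/3})` as `r → ∞`. -/
theorem stmt3 :
    ∃ C > (0 : ℝ), ∃ R > (0 : ℝ), ∀ r : ℝ, R ≤ r →
      0 < mu1 r ∧
      |Real.sqrt (mu1 r) - (r - (1 / 2) * r ^ (-(1 : ℝ) / 3))| ≤ C * r ^ (-(5 : ℝ) / 3) := by
  refine ⟨2, by norm_num, 1, by norm_num, fun r hr => ?_⟩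
  have hr0 : 0 < r := by linarith
  obtain ⟨x, hx0, hx, hmu⟩ := exists_mu1_eq_sub_cardano_root hr0
  obtain ⟨t, ht, rfl, h1, h5⟩ : ∃ t : ℝ, 1 ≤ t ∧ t ^ 3 = r ∧
      r ^ (-(1 : ℝ) / 3) = t⁻¹ ∧ r ^ (-(5 : ℝ) / 3) = t⁻¹ ^ 5 := by
    refine ⟨r ^ ((1 : ℝ) / 3), Real.one_le_rpow hr (by norm_num), ?_, ?_, ?_⟩
    · rw [← Real.rpow_natCast, ← Real.rpow_mul hr0.le]
      norm_num
    · rw [← Real.rpow_neg hr0.le]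
      norm_num
    · rw [← Real.rpow_neg hr0.le, ← Real.rpow_natCast, ← Real.rpow_mul hr0.le]
      norm_num
  have ht0 : 0 < t := by linarith
  obtain ⟨hlt, hle⟩ := cardano_root_bounds ht0 hx0 (hx.trans (by ring))
  rw [h1, h5, hmu]
  have hpos : 0 < (t ^ 3) ^ 2 - x := by
    have : t ^ 2 ≤ t ^ 6 := pow_le_pow_right₀ ht (by norm_num)
    linarith [show (t ^ 3) ^ 2 = t ^ 6 by ring]
  refine ⟨hpos, ?_⟩
  set s := Real.sqrt ((t ^ 3) ^ 2 - x) with hs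
  have hs0 : 0 ≤ s := Real.sqrt_nonneg _
  have hs2 : s ^ 2 = (t ^ 3) ^ 2 - x := Real.sq_sqrt hpos.le
  set q := t ^ 3 - 1 / 2 * t⁻¹ with hq
  have hqt : t ^ 3 / 2 ≤ q := by
    have h1 : t⁻¹ ≤ 1 := inv_le_one_of_one_le₀ ht
    have h2 : 1 ≤ t ^ 3 := one_le_pow₀ ht
    linarith
  have hmul : t * t⁻¹ = 1 := mul_inv_cancel₀ ht0.ne'
  have hdiff : (s - q) * (s + q) = t ^ 2 - x - t⁻¹ ^ 2 / 4 := by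
    rw [hq]
    linear_combination hs2 + t ^ 2 * hmul
  have habs : |s - q| * (s + q) ≤ t⁻¹ ^ 2 := by
    have hsq : 0 ≤ s + q := by linarith [pow_pos ht0 3]
    rw [← abs_of_nonneg hsq, ← abs_mul, hdiff, abs_le]
    have := sq_nonneg t⁻¹
    constructor <;> linarith
  refine le_of_mul_le_mul_right ?_ (show 0 < t ^ 3 / 2 by positivity)
  calc |s - q| * (t ^ 3 / 2) ≤ |s - q| * (s + q) :=
        mul_le_mul_of_nonneg_left (by linarith) (abs_nonneg _)
    _ ≤ t⁻¹ ^ 2 := habs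
    _ = 2 * t⁻¹ ^ 5 * (t ^ 3 / 2) := by field_simp
end

section
/- There exist constants C > 0 and r₀ ∈ (0, 1) such that for all real r with 0 < r ≤ r₀: μ₁(r) > 0 and |√(μ₁(r)) − r³| ≤ C r⁷. In other words, the real eigenvalue λ₁(r) = √(μ₁(r)) of the Stokes–Coriolis characteristic equation satisfies λ₁(r) = r³ + O(r⁷) as r → 0⁺. -/
/-- `μ₁(r) = s³`, where `s = b(r) - a(r)` is the positive root of `s³ + s = r²`. -/
theorem exists_mu1_eq_pow_three {r : ℝ} (hr : 0 < r) :
    ∃ s : ℝ, 0 < s ∧ s ^ 3 + s = r ^ 2 ∧ mu1 r = s ^ 3 := by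
  have hr2 : 0 < r ^ 2 := by positivity
  unfold mu1
  set D := Real.sqrt (r ^ 4 + 4 / 27) with hD
  have hDsq : D ^ 2 = r ^ 4 + 4 / 27 := Real.sq_sqrt (by positivity)
  have hlt : r ^ 2 < D := Real.lt_sqrt_of_sq_lt (by ring_nf; linarith)
  have hx : 0 < (-r ^ 2 + D) / 2 := by linarith
  have hy : 0 < (r ^ 2 + D) / 2 := by linarith
  have cube {x : ℝ} (h : 0 < x) : (x ^ ((1 : ℝ) / 3)) ^ 3 = x := by
    rw [← Real.rpow_natCast, ← Real.rpow_mul h.le]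
    norm_num
  have ha3 := cube hx
  have hb3 := cube hy
  have ha := Real.rpow_pos_of_pos hx ((1 : ℝ) / 3)
  have hb := Real.rpow_pos_of_pos hy ((1 : ℝ) / 3)
  set a := ((-r ^ 2 + D) / 2) ^ ((1 : ℝ) / 3)
  set b := ((r ^ 2 + D) / 2) ^ ((1 : ℝ) / 3)
  have hab : a * b = 1 / 3 := by
    refine (pow_left_inj₀ (mul_pos ha hb).le (by norm_num) (three_ne_zero)).mp ?_
    rw [mul_pow, ha3, hb3]
    linear_combination hDsq / 4
  have hs : (b - a) ^ 3 + (b - a) = r ^ 2 := by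
    linear_combination hb3 - ha3 - 3 * (b - a) * hab
  refine ⟨b - a, ?_, hs, by linear_combination -hs⟩
  have : a < b := lt_of_pow_lt_pow_left₀ 3 hb.le (by rw [ha3, hb3]; linarith)
  linarith

/-- Low-frequency expansion `λ₁(r) = r³ + O(r⁷)` as `r → 0⁺`. -/
theorem stmt4 :
    ∃ C > (0 : ℝ), ∃ r₀ : ℝ, 0 < r₀ ∧ r₀ < 1 ∧ ∀ r : ℝ, 0 < r → r ≤ r₀ →
      0 < mu1 r ∧ |Real.sqrt (mu1 r) - r ^ 3| ≤ C * r ^ 7 := by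
  refine ⟨3, by norm_num, 1 / 2, by norm_num, by norm_num, fun r hr _ => ?_⟩
  obtain ⟨s, hs, hsr, hmu⟩ := exists_mu1_eq_pow_three hr
  obtain ⟨q, hq, rfl⟩ : ∃ q : ℝ, 0 < q ∧ q ^ 2 = s :=
    ⟨Real.sqrt s, Real.sqrt_pos.2 hs, Real.sq_sqrt hs.le⟩
  rw [hmu]
  refine ⟨by positivity, ?_⟩
  rw [show (q ^ 2) ^ 3 = (q ^ 3) ^ 2 by ring, Real.sqrt_sq (by positivity)]
  have hqr : q ≤ r := (pow_le_pow_iff_left₀ hq.le hr.le two_ne_zero).1 (by linarith [show 0 < (q ^ 2) ^ 3 by positivity])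
  have hdiff : r - q ≤ r ^ 5 := by
    have h6 : q ^ 6 ≤ r ^ 6 := by gcongr
    have h : r * (r - q) ≤ r * r ^ 5 := by nlinarith [mul_nonneg hq.le (sub_nonneg.2 hqr)]
    exact le_of_mul_le_mul_left h hr
  have hcube : q ^ 3 ≤ r ^ 3 := by gcongr
  rw [abs_sub_comm, abs_of_nonneg (sub_nonneg.2 hcube)]
  calc r ^ 3 - q ^ 3 = (r - q) * (r ^ 2 + r * q + q ^ 2) := by ring
    _ ≤ r ^ 5 * (r ^ 2 + r * r + r ^ 2) := by gcongr
    _ = 3 * r ^ 7 := by ring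
end

section
/- There exists an absolute constant C > 0 such that for all i, j ∈ {1, 2}, every K > 0, every twice continuously differentiable function φ : ℝ² → ℝ which is bounded and has bounded second-order partial derivatives, and every x ∈ ℝ²: the integral ∫_{ℝ²} γ_{ij}(x−y) [ φ(x) − φ(y) − ∇φ(x)·(x−y) 1_{‖x−y‖≤K} ] dy converges absolutely and its absolute value is at most C ( K ‖∇²φ‖_∞ + K⁻¹ ‖φ‖_∞ ), where ‖∇²φ‖_∞ denotes the supremum over ℝ² of the maximum of the absolute values of the second-order partial derivatives of φ. In particular, taking K = (‖φ‖_∞/‖∇²φ‖_∞)^{1/2} when ∇²φ ≢ 0, the integral is bounded by 2C ‖φ‖_∞^{1/2} ‖∇²φ‖_∞^{1/2}. -/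
open MeasureTheory

/-- The kernel `γ_{ij}(z) = δ_{ij}/‖z‖³ − 3 z_i z_j/‖z‖⁵` on `ℝ²`. -/
noncomputable def gam (i j : Fin 2) (z : EuclideanSpace ℝ (Fin 2)) : ℝ :=
  (if i = j then (1 : ℝ) else 0) / ‖z‖ ^ 3 - 3 * z i * z j / ‖z‖ ^ 5

/-- A linear map on the Euclidean plane is controlled by its values on the standard basis. -/
lemma EuclideanSpace.opNorm_le_two_mul {F : Type*} [NormedAddCommGroup F] [NormedSpace ℝ F]
    (L : EuclideanSpace ℝ (Fin 2) →L[ℝ] F) {c : ℝ}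
    (h : ∀ a, ‖L (EuclideanSpace.single a 1)‖ ≤ c) : ‖L‖ ≤ 2 * c := by
  have hc : 0 ≤ c := (norm_nonneg _).trans (h 0)
  refine L.opNorm_le_bound (by positivity) fun v => ?_
  have hv : v = v 0 • EuclideanSpace.single 0 1 + v 1 • EuclideanSpace.single 1 1 := by
    ext i; fin_cases i <;> simp
  have h0 := PiLp.norm_apply_le v 0
  have h1 := PiLp.norm_apply_le v 1
  calc ‖L v‖ = ‖v 0 • L (EuclideanSpace.single 0 1) + v 1 • L (EuclideanSpace.single 1 1)‖ := by
        conv_lhs => rw [hv]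
        simp only [map_add, map_smul]
    _ ≤ ‖v 0‖ * ‖L (EuclideanSpace.single 0 1)‖ + ‖v 1‖ * ‖L (EuclideanSpace.single 1 1)‖ := by
        simpa only [norm_smul] using
          norm_add_le (v 0 • L (EuclideanSpace.single 0 1)) (v 1 • L (EuclideanSpace.single 1 1))
    _ ≤ ‖v‖ * c + ‖v‖ * c := by gcongr <;> exact h _
    _ = 2 * c * ‖v‖ := by ring

/-- Second-order Taylor estimate on the plane from a bound on the second partial derivatives. -/
lemma abs_sub_sub_fderiv_le {φ : EuclideanSpace ℝ (Fin 2) → ℝ} {c : ℝ} (hφ : ContDiff ℝ 2 φ)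
    (hc : ∀ x (a b : Fin 2),
      |fderiv ℝ (fun z => fderiv ℝ φ z (EuclideanSpace.single a 1)) x
        (EuclideanSpace.single b 1)| ≤ c) (x z : EuclideanSpace ℝ (Fin 2)) :
    |φ x - φ (x - z) - fderiv ℝ φ x z| ≤ 4 * c * ‖z‖ ^ 2 := by
  have hc0 : 0 ≤ c := (abs_nonneg _).trans (hc 0 0 0)
  have hd : Differentiable ℝ φ := hφ.differentiable (by norm_num)
  have hd' : Differentiable ℝ (fderiv ℝ φ) :=
    (hφ.fderiv_right (m := 1) (by norm_num)).differentiable (by norm_num)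
  have hbound : ∀ w, ‖fderiv ℝ (fderiv ℝ φ) w‖ ≤ 4 * c := fun w => by
    have := EuclideanSpace.opNorm_le_two_mul (fderiv ℝ (fderiv ℝ φ) w) (c := 2 * c) fun b =>
      EuclideanSpace.opNorm_le_two_mul _ fun a => by
        have := hc w a b
        rw [fderiv_clm_apply (hd' w) (differentiableAt_const _)] at this
        simpa using this
    linarith
  have hlip : ∀ w ∈ segment ℝ x (x - z), ‖fderiv ℝ φ w - fderiv ℝ φ x‖ ≤ 4 * c * ‖z‖ := by
    intro w hw
    calc ‖fderiv ℝ φ w - fderiv ℝ φ x‖ ≤ 4 * c * ‖w - x‖ :=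
          convex_univ.norm_image_sub_le_of_norm_fderiv_le (fun y _ => hd' y)
            (fun y _ => hbound y) (Set.mem_univ _) (Set.mem_univ _)
      _ ≤ 4 * c * ‖z‖ := by
          gcongr
          simpa using norm_sub_le_of_mem_segment hw
  have := (convex_segment x (x - z)).norm_image_sub_le_of_norm_fderiv_le' (fun y _ => hd y)
    hlip (left_mem_segment ℝ x _) (right_mem_segment ℝ x _)
  rw [← abs_neg]
  convert this using 1
  · rw [Real.norm_eq_abs]
    congr 1
    simp only [sub_sub_cancel_left, map_neg]
    ring
  · simp only [sub_sub_cancel_left, norm_neg]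
    ring

lemma abs_gam_le (i j : Fin 2) (z : EuclideanSpace ℝ (Fin 2)) : |gam i j z| ≤ 4 / ‖z‖ ^ 3 := by
  rcases eq_or_ne z 0 with rfl | hz
  · simp [gam]
  have hz : 0 < ‖z‖ := norm_pos_iff.mpr hz
  have hi : |z i| ≤ ‖z‖ := PiLp.norm_apply_le z i
  have hj : |z j| ≤ ‖z‖ := PiLp.norm_apply_le z j
  calc |gam i j z|
      ≤ |(if i = j then (1 : ℝ) else 0) / ‖z‖ ^ 3| + |3 * z i * z j / ‖z‖ ^ 5| := abs_sub _ _
    _ ≤ 1 / ‖z‖ ^ 3 + 3 * ‖z‖ * ‖z‖ / ‖z‖ ^ 5 := by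
        simp only [abs_div, abs_mul, abs_pow, abs_norm, Nat.abs_ofNat]
        gcongr
        split_ifs <;> simp
    _ = 4 / ‖z‖ ^ 3 := by field_simp; norm_num

lemma measurable_gam (i j : Fin 2) : Measurable (gam i j) := by
  unfold gam
  fun_prop

/-- Radial profile with the singularity `A / r` on `(0, K]` and the tail `B / r ^ 3` beyond. -/
noncomputable def radialMajorant (K A B r : ℝ) : ℝ := if r ≤ K then A / r else B / r ^ 3

lemma integrableOn_integral_mul_radialMajorant {K : ℝ} (hK : 0 < K) (A B : ℝ) :
    IntegrableOn (fun r => r * radialMajorant K A B r) (Set.Ioi 0) ∧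
      ∫ r in Set.Ioi 0, r * radialMajorant K A B r = K * A + K⁻¹ * B := by
  have hin : Set.EqOn (fun r => r * radialMajorant K A B r) (fun _ => A) (Set.Ioc 0 K) := by
    rintro r ⟨h0, h1⟩
    simp only [radialMajorant, if_pos h1]
    field_simp
  have hout : Set.EqOn (fun r => r * radialMajorant K A B r) (fun r => B * r ^ (-2 : ℝ))
      (Set.Ioi K) := by
    intro r hr
    have hr : K < r := hr
    have h0 : 0 < r := hK.trans hr
    simp only [radialMajorant, if_neg hr.not_ge]
    rw [Real.rpow_neg h0.le, Real.rpow_ofNat]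
    field_simp
  have h1 : IntegrableOn (fun r => r * radialMajorant K A B r) (Set.Ioc 0 K) :=
    (integrableOn_congr_fun hin measurableSet_Ioc).mpr (by simp)
  have h2 : IntegrableOn (fun r => r * radialMajorant K A B r) (Set.Ioi K) :=
    (integrableOn_congr_fun hout measurableSet_Ioi).mpr
      ((integrableOn_Ioi_rpow_of_lt (by norm_num) hK).const_mul B)
  rw [← Set.Ioc_union_Ioi_eq_Ioi hK.le]
  refine ⟨h1.union h2, ?_⟩
  rw [setIntegral_union (Set.Ioc_disjoint_Ioi le_rfl) measurableSet_Ioi h1 h2,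
    setIntegral_congr_fun measurableSet_Ioc hin, setIntegral_congr_fun measurableSet_Ioi hout,
    integral_const_mul, integral_Ioi_rpow_of_lt (by norm_num) hK]
  norm_num [hK.le, Real.rpow_neg_one, mul_comm]

lemma integrable_integral_radialMajorant_norm {K : ℝ} (hK : 0 < K) (A B : ℝ) :
    Integrable (fun z : EuclideanSpace ℝ (Fin 2) => radialMajorant K A B ‖z‖) ∧
      ∫ z : EuclideanSpace ℝ (Fin 2), radialMajorant K A B ‖z‖ =
        2 * volume.real (Metric.ball (0 : EuclideanSpace ℝ (Fin 2)) 1) * (K * A + K⁻¹ * B) := by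
  obtain ⟨hint, hval⟩ := integrableOn_integral_mul_radialMajorant hK A B
  constructor
  · rw [integrable_fun_norm_addHaar]
    simpa using hint
  · rw [integral_fun_norm_addHaar]
    simp [hval, mul_assoc]

/-- The integrand is dominated by a radial majorant. -/
lemma abs_gam_mul_le {φ : EuclideanSpace ℝ (Fin 2) → ℝ} {M M2 : ℝ} (hφ : ContDiff ℝ 2 φ)
    (hM : ∀ x, |φ x| ≤ M)
    (hM2 : ∀ x (a b : Fin 2),
      |fderiv ℝ (fun z => fderiv ℝ φ z (EuclideanSpace.single a 1)) x
        (EuclideanSpace.single b 1)| ≤ M2) (i j : Fin 2) (K : ℝ)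
    (x z : EuclideanSpace ℝ (Fin 2)) :
    |gam i j z * (φ x - φ (x - z) - (if ‖z‖ ≤ K then fderiv ℝ φ x z else 0))| ≤
      radialMajorant K (16 * M2) (16 * M) ‖z‖ := by
  have hM0 : 0 ≤ M := (abs_nonneg _).trans (hM 0)
  rw [abs_mul, radialMajorant]
  split_ifs with h
  · calc _ ≤ 4 / ‖z‖ ^ 3 * (4 * M2 * ‖z‖ ^ 2) := by
          gcongr
          · exact abs_gam_le i j z
          · exact abs_sub_sub_fderiv_le hφ hM2 x z
      _ = 16 * M2 / ‖z‖ := by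
          rcases eq_or_ne ‖z‖ 0 with h0 | h0
          · simp [h0]
          · field_simp; ring
  · calc _ ≤ 4 / ‖z‖ ^ 3 * (M + M) := by
          gcongr
          · exact abs_gam_le i j z
          · rw [sub_zero]
            exact (abs_sub _ _).trans (add_le_add (hM _) (hM _))
      _ = 8 * M / ‖z‖ ^ 3 := by ring
      _ ≤ 16 * M / ‖z‖ ^ 3 := by gcongr; norm_num

lemma integrable_and_abs_integral_gam_mul_le {φ : EuclideanSpace ℝ (Fin 2) → ℝ} {M M2 : ℝ}
    (hφ : ContDiff ℝ 2 φ) (hM : ∀ x, |φ x| ≤ M)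
    (hM2 : ∀ x (a b : Fin 2),
      |fderiv ℝ (fun z => fderiv ℝ φ z (EuclideanSpace.single a 1)) x
        (EuclideanSpace.single b 1)| ≤ M2) (i j : Fin 2) {K : ℝ} (hK : 0 < K)
    (x : EuclideanSpace ℝ (Fin 2)) :
    Integrable (fun y => gam i j (x - y) *
      (φ x - φ y - (if ‖x - y‖ ≤ K then fderiv ℝ φ x (x - y) else 0))) ∧
    |∫ y, gam i j (x - y) *
      (φ x - φ y - (if ‖x - y‖ ≤ K then fderiv ℝ φ x (x - y) else 0))|
      ≤ 32 * volume.real (Metric.ball (0 : EuclideanSpace ℝ (Fin 2)) 1) *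
        (K * M2 + K⁻¹ * M) := by
  obtain ⟨hint, hval⟩ := integrable_integral_radialMajorant_norm hK (16 * M2) (16 * M)
  have hle : ∀ y, ‖gam i j (x - y) *
      (φ x - φ y - (if ‖x - y‖ ≤ K then fderiv ℝ φ x (x - y) else 0))‖ ≤
      radialMajorant K (16 * M2) (16 * M) ‖x - y‖ := fun y => by
    simpa using abs_gam_mul_le hφ hM hM2 i j K x (x - y)
  have hint' := hint.comp_sub_left x
  have hmeas : Measurable (fun y => gam i j (x - y) *
      (φ x - φ y - (if ‖x - y‖ ≤ K then fderiv ℝ φ x (x - y) else 0))) := by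
    have := hφ.continuous.measurable
    refine ((measurable_gam i j).comp (by fun_prop)).mul
      ((measurable_const.sub this).sub (Measurable.ite ?_ (by fun_prop) measurable_const))
    exact measurableSet_le (by fun_prop) measurable_const
  refine ⟨hint'.mono' hmeas.aestronglyMeasurable (.of_forall hle), ?_⟩
  refine (norm_integral_le_of_norm_le hint' (.of_forall hle)).trans_eq ?_
  rw [integral_sub_left_eq_self
    (fun z : EuclideanSpace ℝ (Fin 2) => radialMajorant K (16 * M2) (16 * M) ‖z‖) volume x, hval]
  ring

/-- Bound on the singular integral realizing the Fourier multiplier `ξ_i ξ_j / |ξ|`: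
`|I_K φ(x)| ≤ C (K ‖∇²φ‖_∞ + K⁻¹ ‖φ‖_∞)`, and, optimizing in `K`, the bound
`2 C ‖φ‖_∞^{1/2} ‖∇²φ‖_∞^{1/2}`. -/
theorem stmt7 :
    ∃ C > (0 : ℝ),
      (∀ (i j : Fin 2) (K : ℝ), 0 < K →
        ∀ (φ : EuclideanSpace ℝ (Fin 2) → ℝ) (M M2 : ℝ),
        ContDiff ℝ 2 φ →
        (∀ x, |φ x| ≤ M) →
        (∀ x (a b : Fin 2),
          |fderiv ℝ (fun z => fderiv ℝ φ z (EuclideanSpace.single a 1)) x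
            (EuclideanSpace.single b 1)| ≤ M2) →
        ∀ x : EuclideanSpace ℝ (Fin 2),
          Integrable (fun y => gam i j (x - y) *
            (φ x - φ y - (if ‖x - y‖ ≤ K then fderiv ℝ φ x (x - y) else 0))) ∧
          |∫ y, gam i j (x - y) *
            (φ x - φ y - (if ‖x - y‖ ≤ K then fderiv ℝ φ x (x - y) else 0))|
            ≤ C * (K * M2 + K⁻¹ * M)) ∧
      (∀ (i j : Fin 2) (φ : EuclideanSpace ℝ (Fin 2) → ℝ) (M M2 : ℝ),
        ContDiff ℝ 2 φ →
        (∀ x, |φ x| ≤ M) →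
        (∀ x (a b : Fin 2),
          |fderiv ℝ (fun z => fderiv ℝ φ z (EuclideanSpace.single a 1)) x
            (EuclideanSpace.single b 1)| ≤ M2) →
        0 < M → 0 < M2 →
        ∀ x : EuclideanSpace ℝ (Fin 2),
          |∫ y, gam i j (x - y) *
            (φ x - φ y -
              (if ‖x - y‖ ≤ Real.sqrt (M / M2) then fderiv ℝ φ x (x - y) else 0))|
            ≤ 2 * C * Real.sqrt M * Real.sqrt M2) := by
  refine ⟨32 * volume.real (Metric.ball (0 : EuclideanSpace ℝ (Fin 2)) 1), ?_, ?_, ?_⟩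
  · exact mul_pos (by norm_num) (ENNReal.toReal_pos
      (Metric.measure_ball_pos volume _ one_pos).ne' measure_ball_lt_top.ne)
  · intro i j K hK φ M M2 hφ hM hM2 x
    exact integrable_and_abs_integral_gam_mul_le hφ hM hM2 i j hK x
  · intro i j φ M M2 hφ hM hM2 hM0 hM20 x
    refine (integrable_and_abs_integral_gam_mul_le hφ hM hM2 i j
      (Real.sqrt_pos.mpr (div_pos hM0 hM20)) x).2.trans_eq ?_
    have h1 := Real.sqrt_pos.mpr hM0
    have h2 := Real.sqrt_pos.mpr hM20
    have hopt : √(M / M2) * M2 + (√(M / M2))⁻¹ * M = 2 * √M * √M2 := by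
      rw [Real.sqrt_div hM0.le]
      field_simp
      rw [Real.sq_sqrt hM0.le, Real.sq_sqrt hM20.le]
      ring
    rw [hopt]
    ring
end

section
/- There exists a constant C_I > 0 such that for every Schwartz function g ∈ 𝓢(ℝ²; ℂ): the functions ξ ↦ 𝓕g(ξ)/‖ξ‖ and x ↦ g(x)/‖x‖ are both integrable on ℝ², and ∫_{ℝ²} 𝓕g(ξ)/‖ξ‖ dξ = C_I ∫_{ℝ²} g(x)/‖x‖ dx. (Equivalently: the inverse Fourier transform of the locally integrable function 1/‖ξ‖ on ℝ² is C_I/‖x‖.) -/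
open MeasureTheory RealInnerProductSpace
open scoped SchwartzMap
open Set
open scoped FourierTransform

/-- The Gaussian `exp (-π ‖x‖² s²)` as a complex number. -/
noncomputable def scaledGaussian {V : Type*} [NormedAddCommGroup V] (s : ℝ) (x : V) : ℂ :=
  (Real.exp (-(Real.pi * ‖x‖ ^ 2) * s ^ 2) : ℝ)

lemma norm_scaledGaussian {V : Type*} [NormedAddCommGroup V] (s : ℝ) (x : V) :
    ‖scaledGaussian s x‖ = Real.exp (-(Real.pi * ‖x‖ ^ 2) * s ^ 2) := by
  rw [scaledGaussian, Complex.norm_real, Real.norm_of_nonneg (Real.exp_pos _).le]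

lemma scaledGaussian_eq_cexp {V : Type*} [NormedAddCommGroup V] (s : ℝ) (x : V) :
    scaledGaussian s x = Complex.exp (-((Real.pi * s ^ 2 : ℝ) : ℂ) * (‖x‖ : ℂ) ^ 2) := by
  rw [scaledGaussian]
  push_cast
  congr 1
  ring

lemma integral_exp_neg_pi_mul_sq_Ioi {r : ℝ} (hr : 0 < r) :
    ∫ s in Ioi (0 : ℝ), Real.exp (-(Real.pi * r ^ 2) * s ^ 2) = r⁻¹ / 2 := by
  rw [integral_gaussian_Ioi, div_mul_eq_div_div, div_self Real.pi_ne_zero, Real.sqrt_div zero_le_one,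
    Real.sqrt_one, Real.sqrt_sq hr.le, one_div]

/-- A Schwartz function on the plane divided by the norm is integrable. -/
lemma SchwartzMap.integrable_div_norm (g : 𝓢(EuclideanSpace ℝ (Fin 2), ℂ)) :
    Integrable (fun x : EuclideanSpace ℝ (Fin 2) => g x / (‖x‖ : ℂ)) := by
  obtain ⟨C₀, -, h₀⟩ := g.decay 0 0
  obtain ⟨C₂, -, h₂⟩ := g.decay 2 0
  simp only [norm_iteratedFDeriv_zero, pow_zero, one_mul] at h₀ h₂
  have hb : Integrable (fun x : EuclideanSpace ℝ (Fin 2) =>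
      (C₀ + C₂) * (1 + ‖x‖ ^ 2)⁻¹ * ‖x‖⁻¹) := by
    refine (integrable_fun_norm_addHaar (volume : Measure (EuclideanSpace ℝ (Fin 2)))
      (f := fun y : ℝ => (C₀ + C₂) * (1 + y ^ 2)⁻¹ * y⁻¹)).mpr ?_
    refine (integrable_inv_one_add_sq.const_mul (C₀ + C₂)).integrableOn.congr_fun
      (fun y (hy : 0 < y) => ?_) measurableSet_Ioi
    simp only [finrank_euclideanSpace, Fintype.card_fin, smul_eq_mul, Nat.add_one_sub_one, pow_one]
    field_simp
  refine hb.mono' (Measurable.aestronglyMeasurable ?_) (.of_forall fun x => ?_)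
  · exact g.continuous.measurable.div (by fun_prop)
  rw [norm_div, Complex.norm_real, norm_norm, div_eq_mul_inv]
  refine mul_le_mul_of_nonneg_right ?_ (by positivity)
  rw [← div_eq_mul_inv, le_div_iff₀ (by positivity)]
  linarith [h₀ x, h₂ x]

/-- Integrating against scaled Gaussians over all scales recovers the Riesz potential `1/‖x‖`. -/
lemma integral_integral_mul_scaledGaussian {V : Type*} [NormedAddCommGroup V] [MeasurableSpace V]
    [BorelSpace V] {μ : Measure V} [SFinite μ] [NullSingletonClass μ] {f : V → ℂ}
    (hf : AEStronglyMeasurable f μ) (hfi : Integrable (fun x => f x / (‖x‖ : ℂ)) μ) :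
    ∫ s in Ioi (0 : ℝ), ∫ x, f x * scaledGaussian s x ∂μ = (∫ x, f x / (‖x‖ : ℂ) ∂μ) / 2 := by
  have hne : ∀ᵐ x ∂μ, x ≠ 0 := by simp [ae_iff]
  have hpos : ∀ᵐ x ∂μ, 0 < ‖x‖ := hne.mono fun x hx => norm_pos_iff.mpr hx
  have hint : Integrable (Function.uncurry fun (x : V) (s : ℝ) => f x * scaledGaussian s x)
      (μ.prod (volume.restrict (Ioi 0))) := by
    rw [integrable_prod_iff]
    · simp only [Function.uncurry]
      refine ⟨hpos.mono fun x hx => ?_, ?_⟩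
      · exact ((integrable_exp_neg_mul_sq (b := Real.pi * ‖x‖ ^ 2)
          (by positivity)).integrableOn.ofReal).const_mul _
      · refine (hfi.norm.div_const 2).congr (hpos.mono fun x hx => ?_)
        simp only [norm_mul, norm_scaledGaussian, integral_const_mul,
          integral_exp_neg_pi_mul_sq_Ioi hx, norm_div, Complex.norm_real, norm_norm]
        ring
    · refine (hf.comp_fst).mul (Measurable.aestronglyMeasurable ?_)
      unfold scaledGaussian
      fun_prop
  rw [← integral_integral_swap hint, ← integral_div]
  refine integral_congr_ae (hpos.mono fun x hx => ?_)
  simp only [scaledGaussian, integral_const_mul, integral_complex_ofReal,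
    integral_exp_neg_pi_mul_sq_Ioi hx]
  push_cast
  ring

lemma integrable_scaledGaussian {V : Type*} [NormedAddCommGroup V] [InnerProductSpace ℝ V]
    [FiniteDimensional ℝ V] [MeasurableSpace V] [BorelSpace V] {s : ℝ} (hs : 0 < s) :
    Integrable (scaledGaussian s : V → ℂ) := by
  have h := GaussianFourier.integrable_cexp_neg_mul_sq_norm_add (V := V)
    (b := ((Real.pi * s ^ 2 : ℝ) : ℂ)) (by rw [Complex.ofReal_re]; positivity) 0 0
  refine h.congr (.of_forall fun x => ?_)
  simp only [scaledGaussian_eq_cexp, zero_mul, add_zero]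

lemma fourier_scaledGaussian {s : ℝ} (hs : 0 < s) (ξ : EuclideanSpace ℝ (Fin 2)) :
    𝓕 (scaledGaussian s : EuclideanSpace ℝ (Fin 2) → ℂ) ξ
      = ((s ^ 2)⁻¹ : ℝ) * scaledGaussian s⁻¹ ξ := by
  have h := fourier_gaussian_innerProductSpace (V := EuclideanSpace ℝ (Fin 2))
    (b := ((Real.pi * s ^ 2 : ℝ) : ℂ)) (by rw [Complex.ofReal_re]; positivity) ξ
  have hs' : (s : ℂ) ≠ 0 := by exact_mod_cast hs.ne'
  have hpi : (Real.pi : ℂ) ≠ 0 := by exact_mod_cast Real.pi_ne_zero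
  simp only [← scaledGaussian_eq_cexp] at h
  refine h.trans ?_
  rw [scaledGaussian_eq_cexp, finrank_euclideanSpace, Fintype.card_fin, Nat.cast_ofNat,
    div_self two_ne_zero, Complex.cpow_one]
  push_cast
  congr 1
  · field_simp
  · congr 1
    field_simp

lemma integral_fourier_mul_scaledGaussian (g : 𝓢(EuclideanSpace ℝ (Fin 2), ℂ)) {s : ℝ}
    (hs : 0 < s) :
    ∫ ξ, 𝓕 g ξ * scaledGaussian s ξ = ((s ^ 2)⁻¹ : ℝ) * ∫ x, g x * scaledGaussian s⁻¹ x := by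
  have h := VectorFourier.integral_bilin_fourierIntegral_eq_flip (.mul ℂ ℂ)
    (L := innerₗ (EuclideanSpace ℝ (Fin 2))) Real.continuous_fourierChar continuous_inner
    (g.integrable (μ := volume)) (integrable_scaledGaussian hs)
  rw [flip_innerₗ] at h
  change ∫ ξ, 𝓕 g ξ * scaledGaussian s ξ = ∫ x,
    g x * 𝓕 (scaledGaussian s : EuclideanSpace ℝ (Fin 2) → ℂ) x at h
  rw [h, ← integral_const_mul]
  refine integral_congr_ae (.of_forall fun x => ?_)
  simp only [fourier_scaledGaussian hs]
  ring

/-- The function `1/‖x‖` on the plane is its own Fourier transform. -/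
lemma integral_fourier_div_norm (g : 𝓢(EuclideanSpace ℝ (Fin 2), ℂ)) :
    ∫ ξ, 𝓕 g ξ / (‖ξ‖ : ℂ) = ∫ x, g x / (‖x‖ : ℂ) := by
  have h₁ := integral_integral_mul_scaledGaussian
    (𝓕 g).continuous.aestronglyMeasurable (𝓕 g).integrable_div_norm
  have h₂ := integral_integral_mul_scaledGaussian
    g.continuous.aestronglyMeasurable g.integrable_div_norm
  have h₃ := integral_comp_rpow_Ioi (fun s => ∫ x, g x * scaledGaussian s x)
    (p := -1) (by norm_num)
  rw [h₂] at h₃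
  rw [← div_left_inj' (two_ne_zero (α := ℂ)), ← h₁, ← h₃]
  refine setIntegral_congr_fun measurableSet_Ioi fun s (hs : 0 < s) => ?_
  simp only [integral_fourier_mul_scaledGaussian g hs, Complex.real_smul, Real.rpow_neg_one]
  congr 2
  rw [abs_neg, abs_one, one_mul, show (-1 - 1 : ℝ) = -(2 : ℕ) by norm_num,
    Real.rpow_neg hs.le, Real.rpow_natCast]

/-- The inverse Fourier transform of `1/‖ξ‖` on `ℝ²` is `C_I/‖x‖`: for every
Schwartz function `g`, `∫ 𝓕g(ξ)/‖ξ‖ dξ = C_I ∫ g(x)/‖x‖ dx`. -/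
theorem stmt14 :
    ∃ C : ℝ, 0 < C ∧ ∀ g : 𝓢(EuclideanSpace ℝ (Fin 2), ℂ),
      Integrable (fun ξ : EuclideanSpace ℝ (Fin 2) =>
        (∫ x : EuclideanSpace ℝ (Fin 2),
          Complex.exp (-(2 * Real.pi * Complex.I * (⟪x, ξ⟫ : ℝ))) * g x) / (‖ξ‖ : ℂ)) ∧
      Integrable (fun x : EuclideanSpace ℝ (Fin 2) => g x / (‖x‖ : ℂ)) ∧
      ∫ ξ : EuclideanSpace ℝ (Fin 2),
          (∫ x : EuclideanSpace ℝ (Fin 2),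
            Complex.exp (-(2 * Real.pi * Complex.I * (⟪x, ξ⟫ : ℝ))) * g x) / (‖ξ‖ : ℂ)
        = (C : ℂ) * ∫ x : EuclideanSpace ℝ (Fin 2), g x / (‖x‖ : ℂ) := by
  refine ⟨1, one_pos, fun g => ?_⟩
  have hg : ∀ ξ : EuclideanSpace ℝ (Fin 2), (∫ x : EuclideanSpace ℝ (Fin 2),
      Complex.exp (-(2 * Real.pi * Complex.I * (⟪x, ξ⟫ : ℝ))) * g x) = 𝓕 g ξ := by
    intro ξ
    rw [SchwartzMap.fourier_coe, Real.fourier_eq']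
    refine integral_congr_ae (.of_forall fun x => ?_)
    simp only [smul_eq_mul]
    congr 2
    push_cast
    ring
  simp only [hg]
  refine ⟨(𝓕 g).integrable_div_norm, g.integrable_div_norm, ?_⟩
  rw [integral_fourier_div_norm, Complex.ofReal_one, one_mul]
end

section
/- Let U : ℝ² → ℝ be twice continuously differentiable with compact support, and assume U(0) = 0 and ∇U(0) = 0. Then for all i, j ∈ {1, 2}: the functions y ↦ ∂_i∂_j U(y)/‖y‖ and y ↦ U(y) ( 3 y_i y_j/‖y‖⁵ − δ_{ij}/‖y‖³ ) are integrable on ℝ², and ∫_{ℝ²} ∂_i∂_j U(y)/‖y‖ dy = ∫_{ℝ²} U(y) ( 3 y_i y_j/‖y‖⁵ − δ_{ij}/‖y‖³ ) dy. -/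
open MeasureTheory

open Filter Topology

/-- The regularised norm `√(‖y‖² + a)` has partial derivatives `y_j / √(‖y‖² + a)`. -/
lemma hasLineDerivAt_sqrt_norm_sq_add {a : ℝ} (ha : 0 < a) (y : EuclideanSpace ℝ (Fin 2))
    (j : Fin 2) :
    HasLineDerivAt ℝ (fun z : EuclideanSpace ℝ (Fin 2) => √(‖z‖ ^ 2 + a))
      (y j / √(‖y‖ ^ 2 + a)) y (EuclideanSpace.single j 1) := by
  have hexp (t : ℝ) : ‖y + t • EuclideanSpace.single j (1 : ℝ)‖ ^ 2 + a =
      ‖y‖ ^ 2 + 2 * y j * t + t ^ 2 + a := by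
    rw [norm_add_sq_real, norm_smul, inner_smul_right, EuclideanSpace.inner_single_right]
    simp
    ring
  have hpos : 0 < ‖y‖ ^ 2 + a := by positivity
  unfold HasLineDerivAt
  simp only [hexp]
  have h : HasDerivAt (fun t : ℝ => ‖y‖ ^ 2 + 2 * y j * t + t ^ 2 + a) (2 * y j) 0 := by
    have h1 := (((hasDerivAt_id (0 : ℝ)).const_mul (2 * y j)).const_add (‖y‖ ^ 2)).add
      (hasDerivAt_pow 2 (0 : ℝ)) |>.add_const a
    simpa using h1
  convert! h.sqrt (by simpa using hpos.ne') using 1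
  simp
  ring

lemma hasLineDerivAt_inv_sqrt_norm_sq_add {a : ℝ} (ha : 0 < a) (y : EuclideanSpace ℝ (Fin 2))
    (j : Fin 2) :
    HasLineDerivAt ℝ (fun z : EuclideanSpace ℝ (Fin 2) => (√(‖z‖ ^ 2 + a))⁻¹)
      (-(y j / √(‖y‖ ^ 2 + a) ^ 3)) y (EuclideanSpace.single j 1) := by
  have hpos : 0 < √(‖y‖ ^ 2 + a) := by positivity
  have h := hasLineDerivAt_sqrt_norm_sq_add ha y j
  unfold HasLineDerivAt at h ⊢
  convert! h.fun_inv (by simpa using hpos.ne') using 1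
  simp
  field_simp

lemma hasLineDerivAt_neg_coord_div_sqrt_norm_sq_add {a : ℝ} (ha : 0 < a)
    (y : EuclideanSpace ℝ (Fin 2)) (i j : Fin 2) :
    HasLineDerivAt ℝ (fun z : EuclideanSpace ℝ (Fin 2) => -(z j / √(‖z‖ ^ 2 + a) ^ 3))
      (3 * y i * y j / √(‖y‖ ^ 2 + a) ^ 5 -
        (if i = j then (1 : ℝ) else 0) / √(‖y‖ ^ 2 + a) ^ 3) y (EuclideanSpace.single i 1) := by
  have hpos : 0 < √(‖y‖ ^ 2 + a) := by positivity
  have h := hasLineDerivAt_sqrt_norm_sq_add ha y i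
  have hcoord : HasDerivAt
      (fun t : ℝ => (y + t • EuclideanSpace.single i (1 : ℝ)) j)
      (if i = j then (1 : ℝ) else 0) 0 := by
    have h1 := ((hasDerivAt_id (0 : ℝ)).mul_const (if i = j then (1 : ℝ) else 0)).const_add (y j)
    simpa [Pi.single_apply, eq_comm] using h1
  unfold HasLineDerivAt at h ⊢
  convert! (hcoord.fun_div (h.fun_pow 3) (by simpa using (pow_pos hpos 3).ne')).fun_neg using 1
  simp only [Nat.cast_ofNat, Nat.add_one_sub_one, zero_smul, add_zero]
  split_ifs <;> field_simp <;> ring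

/-- A measurable function on the plane supported in a ball and bounded by `C / ‖y‖` is
integrable. -/
lemma integrable_of_abs_le_div_norm {F : EuclideanSpace ℝ (Fin 2) → ℝ} {C R : ℝ}
    (hF : Measurable F) (hle : ∀ y, |F y| ≤ C / ‖y‖) (hR : ∀ y, y ∉ Metric.ball 0 R → F y = 0) :
    Integrable F := by
  have h : IntegrableOn F (Metric.ball 0 R) := by
    refine integrableOn_ball_of_norm_le_rpow (C := C) (α := 1) (by simp) (by simp) ?_
      hF.aestronglyMeasurable
    refine Eventually.of_forall fun y => ?_
    simpa [Real.rpow_neg_one, div_eq_mul_inv] using hle y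
  exact (integrableOn_iff_integrable_of_support_subset fun y hy => by
    by_contra hy'
    exact hy (hR y hy')).1 h

/-- A `C²` function with compact support that vanishes to second order at the origin is
`O(‖y‖²)`. -/
lemma exists_abs_le_mul_norm_sq {E : Type*} [NormedAddCommGroup E] [NormedSpace ℝ E] {U : E → ℝ}
    (hU : ContDiff ℝ 2 U) (hc : HasCompactSupport U) (h0 : U 0 = 0) (h0' : fderiv ℝ U 0 = 0) :
    ∃ C, 0 ≤ C ∧ ∀ y, |U y| ≤ C * ‖y‖ ^ 2 := by
  have h1 : ContDiff ℝ 1 (fderiv ℝ U) := hU.fderiv_right (by norm_num)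
  obtain ⟨C, hC⟩ := h1.lipschitzWith_of_hasCompactSupport (hc.fderiv ℝ) (by norm_num)
  refine ⟨C, C.2, fun y => ?_⟩
  have hb : ∀ x ∈ Metric.closedBall (0 : E) ‖y‖, ‖fderiv ℝ U x‖ ≤ C * ‖y‖ := fun x hx => by
    have := hC.norm_sub_le x 0
    rw [h0', sub_zero, sub_zero] at this
    refine this.trans ?_
    gcongr
    simpa using hx
  have := (convex_closedBall (0 : E) ‖y‖).norm_image_sub_le_of_norm_fderiv_le (𝕜 := ℝ)
    (fun x _ => (hU.differentiable (by norm_num)) x) hb (by simp : (0 : E) ∈ _)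
    (by simp : y ∈ _)
  rw [h0, sub_zero, sub_zero, Real.norm_eq_abs] at this
  linarith

/-- If `‖y‖ ≤ s`, the kernel `3 y_i y_j / s⁵ - δ_{ij} / s³` is bounded by `4 / ‖y‖³`. -/
lemma abs_hessian_kernel_le (y : EuclideanSpace ℝ (Fin 2)) (i j : Fin 2) {s : ℝ} (hy : y ≠ 0)
    (hs : ‖y‖ ≤ s) :
    |3 * y i * y j / s ^ 5 - (if i = j then (1 : ℝ) else 0) / s ^ 3| ≤ 4 / ‖y‖ ^ 3 := by
  have hn : 0 < ‖y‖ := norm_pos_iff.2 hy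
  have hs0 : 0 < s := hn.trans_le hs
  have hcoord (k : Fin 2) : |y k| ≤ s := (PiLp.norm_apply_le y k).trans hs
  have h1 : |3 * y i * y j / s ^ 5| ≤ 3 / s ^ 3 := by
    rw [abs_div, abs_mul, abs_mul, abs_of_pos (pow_pos hs0 5), div_le_div_iff₀ (by positivity)
      (by positivity), abs_of_pos (by norm_num : (0 : ℝ) < 3)]
    calc 3 * |y i| * |y j| * s ^ 3 ≤ 3 * s * s * s ^ 3 := by gcongr <;> exact hcoord _
      _ = 3 * s ^ 5 := by ring
  have h2 : |(if i = j then (1 : ℝ) else 0) / s ^ 3| ≤ 1 / s ^ 3 := by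
    rw [abs_div, abs_of_pos (pow_pos hs0 3)]
    gcongr
    split_ifs <;> simp
  calc _ ≤ 3 / s ^ 3 + 1 / s ^ 3 := (abs_sub _ _).trans (add_le_add h1 h2)
    _ = 4 / s ^ 3 := by ring
    _ ≤ 4 / ‖y‖ ^ 3 := by gcongr

/-- Two integrations by parts against the regularised kernel `1 / √(‖y‖² + a)`. -/
lemma integral_fderiv_fderiv_div_sqrt_norm_sq_add {U : EuclideanSpace ℝ (Fin 2) → ℝ}
    (hU : ContDiff ℝ 2 U) (hc : HasCompactSupport U) (i j : Fin 2) {a : ℝ} (ha : 0 < a) :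
    ∫ y : EuclideanSpace ℝ (Fin 2),
        fderiv ℝ (fun z => fderiv ℝ U z (EuclideanSpace.single i 1)) y
          (EuclideanSpace.single j 1) / √(‖y‖ ^ 2 + a)
      = ∫ y : EuclideanSpace ℝ (Fin 2),
          U y * (3 * y i * y j / √(‖y‖ ^ 2 + a) ^ 5 -
            (if i = j then (1 : ℝ) else 0) / √(‖y‖ ^ 2 + a) ^ 3) := by
  have hne (y : EuclideanSpace ℝ (Fin 2)) : √(‖y‖ ^ 2 + a) ≠ 0 := by positivity
  have hV : ContDiff ℝ 1 (fun z => fderiv ℝ U z (EuclideanSpace.single i 1)) :=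
    (hU.fderiv_right (by norm_num)).clm_apply contDiff_const
  have hVc : HasCompactSupport (fun z => fderiv ℝ U z (EuclideanSpace.single i 1)) :=
    hc.fderiv_apply ℝ _
  have hW : Continuous (fun y => fderiv ℝ (fun z => fderiv ℝ U z (EuclideanSpace.single i 1)) y
      (EuclideanSpace.single j 1)) := (hV.continuous_fderiv (by norm_num)).clm_apply continuous_const
  have hWc := hVc.fderiv_apply ℝ (EuclideanSpace.single j (1 : ℝ))
  have hk : Continuous fun y : EuclideanSpace ℝ (Fin 2) => (√(‖y‖ ^ 2 + a))⁻¹ := by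
    fun_prop (disch := exact hne)
  have hk' : Continuous fun y : EuclideanSpace ℝ (Fin 2) => -(y j / √(‖y‖ ^ 2 + a) ^ 3) := by
    fun_prop (disch := exact fun y => pow_ne_zero _ (hne y))
  have hk'' : Continuous fun y : EuclideanSpace ℝ (Fin 2) =>
      3 * y i * y j / √(‖y‖ ^ 2 + a) ^ 5 -
        (if i = j then (1 : ℝ) else 0) / √(‖y‖ ^ 2 + a) ^ 3 := by
    fun_prop (disch := exact fun y => pow_ne_zero _ (hne y))
  have hVd := hV.differentiable (by norm_num)
  have hUd := hU.differentiable (by norm_num)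
  have h1 := integral_bilinear_hasLineDerivAt_right_eq_neg_left_of_integrable
    (μ := (volume : Measure (EuclideanSpace ℝ (Fin 2)))) (B := ContinuousLinearMap.mul ℝ ℝ)
    (((hk'.mul hV.continuous).integrable_of_hasCompactSupport hVc.mul_left))
    (((hk.mul hW).integrable_of_hasCompactSupport hWc.mul_left))
    (((hk.mul hV.continuous).integrable_of_hasCompactSupport hVc.mul_left))
    (fun y _ => hasLineDerivAt_inv_sqrt_norm_sq_add ha y j)
    (fun y _ => (hVd y).hasFDerivAt.hasLineDerivAt _)
  have h2 := integral_bilinear_hasLineDerivAt_right_eq_neg_left_of_integrable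
    (μ := (volume : Measure (EuclideanSpace ℝ (Fin 2)))) (B := ContinuousLinearMap.mul ℝ ℝ)
    (((hk''.mul hU.continuous).integrable_of_hasCompactSupport hc.mul_left))
    (((hk'.mul hV.continuous).integrable_of_hasCompactSupport hVc.mul_left))
    (((hk'.mul hU.continuous).integrable_of_hasCompactSupport hc.mul_left))
    (fun y _ => hasLineDerivAt_neg_coord_div_sqrt_norm_sq_add ha y i j)
    (fun y _ => (hUd y).hasFDerivAt.hasLineDerivAt _)
  simp only [ContinuousLinearMap.mul_apply'] at h1 h2
  rw [h2, neg_neg] at h1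
  simpa only [div_eq_inv_mul, mul_comm (U _)] using h1

/-- Singular integration by parts: for `U ∈ C²_c(ℝ²)` vanishing to second order at
the origin, `∫ ∂_i∂_j U(y)/‖y‖ dy = ∫ U(y) (3 y_i y_j/‖y‖⁵ − δ_{ij}/‖y‖³) dy`. -/
theorem stmt15 (U : EuclideanSpace ℝ (Fin 2) → ℝ)
    (hU : ContDiff ℝ 2 U) (hc : HasCompactSupport U)
    (h0 : U 0 = 0) (h0' : fderiv ℝ U 0 = 0) (i j : Fin 2) :
    Integrable (fun y : EuclideanSpace ℝ (Fin 2) =>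
      fderiv ℝ (fun z => fderiv ℝ U z (EuclideanSpace.single i 1)) y
        (EuclideanSpace.single j 1) / ‖y‖) ∧
    Integrable (fun y : EuclideanSpace ℝ (Fin 2) =>
      U y * (3 * y i * y j / ‖y‖ ^ 5 - (if i = j then (1 : ℝ) else 0) / ‖y‖ ^ 3)) ∧
    ∫ y : EuclideanSpace ℝ (Fin 2),
        fderiv ℝ (fun z => fderiv ℝ U z (EuclideanSpace.single i 1)) y
          (EuclideanSpace.single j 1) / ‖y‖
      = ∫ y : EuclideanSpace ℝ (Fin 2),
          U y * (3 * y i * y j / ‖y‖ ^ 5 - (if i = j then (1 : ℝ) else 0) / ‖y‖ ^ 3) := by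
  have hV : ContDiff ℝ 1 (fun z => fderiv ℝ U z (EuclideanSpace.single i 1)) :=
    (hU.fderiv_right (by norm_num)).clm_apply contDiff_const
  have hW : Continuous (fun y => fderiv ℝ (fun z => fderiv ℝ U z (EuclideanSpace.single i 1)) y
      (EuclideanSpace.single j 1)) := (hV.continuous_fderiv (by norm_num)).clm_apply continuous_const
  have hWc : HasCompactSupport (fun y =>
      fderiv ℝ (fun z => fderiv ℝ U z (EuclideanSpace.single i 1)) y
        (EuclideanSpace.single j 1)) :=
    (hc.fderiv_apply ℝ _).fderiv_apply ℝ _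
  obtain ⟨C, hC0, hC⟩ := exists_abs_le_mul_norm_sq hU hc h0 h0'
  obtain ⟨D, hD⟩ := hWc.exists_bound_of_continuous hW
  obtain ⟨R, hR⟩ := hc.isBounded.subset_ball 0
  obtain ⟨S, hS⟩ := hWc.isBounded.subset_ball 0
  have hint₁ : Integrable (fun y : EuclideanSpace ℝ (Fin 2) =>
      fderiv ℝ (fun z => fderiv ℝ U z (EuclideanSpace.single i 1)) y
        (EuclideanSpace.single j 1) / ‖y‖) := by
    refine integrable_of_abs_le_div_norm (C := D) (R := S) (hW.measurable.div measurable_norm)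
      (fun y => ?_) (fun y hy => ?_)
    · rw [abs_div, abs_norm]
      gcongr
      exact hD y
    · simp only [image_eq_zero_of_notMem_tsupport fun h => hy (hS h), zero_div]
  have hbound : Integrable (fun y : EuclideanSpace ℝ (Fin 2) => |U y| * (4 / ‖y‖ ^ 3)) := by
    refine integrable_of_abs_le_div_norm (C := C * 4) (R := R)
      (hU.continuous.abs.measurable.mul (measurable_const.div (measurable_norm.pow_const 3)))
      (fun y => ?_) (fun y hy => ?_)
    · rcases eq_or_ne y 0 with rfl | hy
      · simp
      have hn : 0 < ‖y‖ := norm_pos_iff.2 hy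
      rw [abs_of_nonneg (by positivity)]
      calc |U y| * (4 / ‖y‖ ^ 3) ≤ C * ‖y‖ ^ 2 * (4 / ‖y‖ ^ 3) := by gcongr; exact hC y
        _ = C * 4 / ‖y‖ := by field_simp
    · rw [image_eq_zero_of_notMem_tsupport fun h => hy (hR h), abs_zero, zero_mul]
  have hmeas (s : EuclideanSpace ℝ (Fin 2) → ℝ) (hs : Continuous s) :
      AEStronglyMeasurable (fun y : EuclideanSpace ℝ (Fin 2) =>
        U y * (3 * y i * y j / s y ^ 5 - (if i = j then (1 : ℝ) else 0) / s y ^ 3)) := by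
    have hcont (n : ℕ) : Measurable fun y => s y ^ n := (hs.pow n).measurable
    have hnum : Measurable fun y : EuclideanSpace ℝ (Fin 2) => 3 * y i * y j :=
      (by fun_prop : Continuous _).measurable
    exact (hU.continuous.measurable.mul ((hnum.div (hcont 5)).sub
      (measurable_const.div (hcont 3)))).aestronglyMeasurable
  have hne : ∀ᵐ y : EuclideanSpace ℝ (Fin 2), y ≠ 0 := by
    simp [ae_iff]
  have hle (y : EuclideanSpace ℝ (Fin 2)) {a : ℝ} (ha : 0 ≤ a) : ‖y‖ ≤ √(‖y‖ ^ 2 + a) :=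
    Real.le_sqrt_of_sq_le (by linarith)
  have hker (y : EuclideanSpace ℝ (Fin 2)) (hy : y ≠ 0) {s : ℝ} (hs : ‖y‖ ≤ s) :
      ‖U y * (3 * y i * y j / s ^ 5 - (if i = j then (1 : ℝ) else 0) / s ^ 3)‖ ≤
        |U y| * (4 / ‖y‖ ^ 3) := by
    rw [Real.norm_eq_abs, abs_mul]
    gcongr
    exact abs_hessian_kernel_le y i j hy hs
  have hsqrt (y : EuclideanSpace ℝ (Fin 2)) :
      Tendsto (fun a : ℝ => √(‖y‖ ^ 2 + a)) (𝓝[>] 0) (𝓝 ‖y‖) := by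
    have h : Continuous fun a : ℝ => √(‖y‖ ^ 2 + a) := by fun_prop
    have h' := (h.tendsto 0).mono_left (nhdsWithin_le_nhds (s := Set.Ioi 0))
    simpa [Real.sqrt_sq (norm_nonneg y)] using h'
  refine ⟨hint₁, hbound.mono' (hmeas _ continuous_norm) (hne.mono fun y hy => hker y hy le_rfl), ?_⟩
  have hlim₁ := tendsto_integral_filter_of_dominated_convergence (μ := volume) (l := 𝓝[>] (0 : ℝ))
    (F := fun a (y : EuclideanSpace ℝ (Fin 2)) =>
      fderiv ℝ (fun z => fderiv ℝ U z (EuclideanSpace.single i 1)) y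
        (EuclideanSpace.single j 1) / √(‖y‖ ^ 2 + a)) _
    (Eventually.of_forall fun a => (hW.measurable.div
      (by fun_prop : Continuous fun y : EuclideanSpace ℝ (Fin 2) =>
        √(‖y‖ ^ 2 + a)).measurable).aestronglyMeasurable)
    (eventually_mem_nhdsWithin.mono fun a (ha : 0 < a) => hne.mono fun y hy => by
      have hn : 0 < ‖y‖ := norm_pos_iff.2 hy
      rw [norm_div, Real.norm_of_nonneg (Real.sqrt_nonneg _)]
      exact (div_le_div_of_nonneg_left (norm_nonneg _) hn (hle y ha.le)).trans_eq
        (by rw [norm_div, norm_norm]))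
    hint₁.norm
    (hne.mono fun y hy => tendsto_const_nhds.div (hsqrt y) (norm_ne_zero_iff.2 hy))
  have hlim₂ := tendsto_integral_filter_of_dominated_convergence (μ := volume) (l := 𝓝[>] (0 : ℝ))
    (F := fun a (y : EuclideanSpace ℝ (Fin 2)) =>
      U y * (3 * y i * y j / √(‖y‖ ^ 2 + a) ^ 5 -
        (if i = j then (1 : ℝ) else 0) / √(‖y‖ ^ 2 + a) ^ 3)) _
    (Eventually.of_forall fun a => hmeas _ (by fun_prop))
    (eventually_mem_nhdsWithin.mono fun a (ha : 0 < a) =>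
      hne.mono fun y hy => hker y hy (hle y ha.le))
    hbound
    (hne.mono fun y hy => tendsto_const_nhds.mul
      ((tendsto_const_nhds.div ((hsqrt y).pow 5) (pow_ne_zero 5 (norm_ne_zero_iff.2 hy))).sub
        (tendsto_const_nhds.div ((hsqrt y).pow 3) (pow_ne_zero 3 (norm_ne_zero_iff.2 hy)))))
  exact tendsto_nhds_unique_of_eventuallyEq hlim₁ hlim₂
    (eventually_mem_nhdsWithin.mono fun a ha =>
      integral_fderiv_fderiv_div_sqrt_norm_sq_add hU hc i j ha)
end

section
/- Let C₀, C₁ > 0. There exist constants C₂, C₃ > 0 and a natural number m₀ ≥ 1, depending only on C₀ and C₁, with the following property. Let n ≥ 1 be a natural number and let (E_k)_{k∈ℕ} be a nondecreasing sequence of nonnegative real numbers such that E_k ≤ C₀ n² for all k, and such that for all natural numbers m, k with 1 ≤ m ≤ k: E_k ≤ C₁ [ k² + (E_{k+m+1} − E_k) + (k⁴/m⁵) · sup_{j ≥ m+k} (E_{j+m} − E_j)/j ]. Then for all natural numbers m ≥ m₀ and all k ≥ C₃ m: E_k ≤ C₂ [ k² + m³ + (k⁴/m⁵) · sup_{j ≥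 m+k} (E_{j+m} − E_j)/j ]. -/
/-- `tailSup E m p = sup_{j ≥ p} (E_{j+m} − E_j)/j`. -/
noncomputable def tailSup (E : ℕ → ℝ) (m p : ℕ) : ℝ :=
  ⨆ j : {j : ℕ // p ≤ j}, (E (j.1 + m) - E j.1) / (j.1 : ℝ)

theorem bddAbove_range_tailSup {E : ℕ → ℝ} {B : ℝ} (hE0 : ∀ k, 0 ≤ E k) (hB : ∀ k, E k ≤ B)
    (m p : ℕ) :
    BddAbove (Set.range fun j : {j : ℕ // p ≤ j} => (E (j.1 + m) - E j.1) / (j.1 : ℝ)) := by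
  have hB0 : 0 ≤ B := (hE0 0).trans (hB 0)
  refine ⟨B, ?_⟩
  rintro _ ⟨⟨j, hj⟩, rfl⟩
  rcases Nat.eq_zero_or_pos j with rfl | hpos
  · simpa using hB0
  · have h1 : (1 : ℝ) ≤ j := by exact_mod_cast hpos
    simp only
    rw [div_le_iff₀ (by linarith)]
    nlinarith [hE0 j, hB (j + m)]

theorem tailSup_nonneg {E : ℕ → ℝ} (hE : Monotone E) (m p : ℕ) : 0 ≤ tailSup E m p :=
  Real.iSup_nonneg fun _ =>
    div_nonneg (sub_nonneg.2 (hE (Nat.le_add_right _ _))) (Nat.cast_nonneg _)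

theorem tailSup_anti {E : ℕ → ℝ} {B : ℝ} (hE0 : ∀ k, 0 ≤ E k) (hB : ∀ k, E k ≤ B)
    (m : ℕ) {p q : ℕ} (hpq : p ≤ q) : tailSup E m q ≤ tailSup E m p := by
  have : Nonempty {j : ℕ // q ≤ j} := ⟨⟨q, le_rfl⟩⟩
  exact ciSup_le fun j =>
    le_ciSup (bddAbove_range_tailSup hE0 hB m p) ⟨j.1, hpq.trans j.2⟩

/-- A bounded sequence satisfying a backward contraction with a quartically growing source term
is controlled at the origin by the source. -/
theorem le_tsum_of_backward_contraction {θ A B : ℝ} (hθ0 : 0 ≤ θ) (hθ1 : θ < 1) (hA : 0 ≤ A)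
    {a : ℕ → ℝ} (hB : ∀ i, a i ≤ B)
    (h : ∀ i, a i ≤ θ * (a (i + 1) + A * ((i : ℝ) + 1) ^ 4)) :
    a 0 ≤ A * ∑' i : ℕ, (i : ℝ) ^ 4 * θ ^ i := by
  have hs : Summable fun i : ℕ => (i : ℝ) ^ 4 * θ ^ i :=
    summable_pow_mul_geometric_of_norm_lt_one 4 (by rwa [Real.norm_of_nonneg hθ0])
  have iter : ∀ N : ℕ, a 0 ≤ θ ^ N * a N +
      A * ∑ i ∈ Finset.range (N + 1), (i : ℝ) ^ 4 * θ ^ i := by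
    intro N
    induction N with
    | zero => simp
    | succ N ih =>
      rw [Finset.sum_range_succ]
      have := mul_le_mul_of_nonneg_left (h N) (pow_nonneg hθ0 N)
      push_cast
      refine ih.trans (le_of_le_of_eq (add_le_add_left this _) ?_)
      ring
  have bound : ∀ N : ℕ, a 0 ≤ θ ^ N * B + A * ∑' i : ℕ, (i : ℝ) ^ 4 * θ ^ i := by
    intro N
    refine (iter N).trans (add_le_add ?_ ?_)
    · exact mul_le_mul_of_nonneg_left (hB N) (pow_nonneg hθ0 N)
    · exact mul_le_mul_of_nonneg_left
        (hs.sum_le_tsum _ fun i _ => mul_nonneg (by positivity) (pow_nonneg hθ0 i)) hA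
  have lim := ((tendsto_pow_atTop_nhds_zero_of_lt_one hθ0 hθ1).mul_const B).add_const
    (A * ∑' i : ℕ, (i : ℝ) ^ 4 * θ ^ i)
  rw [zero_mul, zero_add] at lim
  exact ge_of_tendsto' lim bound

/-- Downward induction turning the Saint-Venant estimate into a uniform bound:
if `E_k ≤ C₀ n²` and
`E_k ≤ C₁ [k² + (E_{k+m+1} − E_k) + (k⁴/m⁵) sup_{j ≥ m+k} (E_{j+m} − E_j)/j]`
for all `1 ≤ m ≤ k`, then
`E_k ≤ C₂ [k² + m³ + (k⁴/m⁵) sup_{j ≥ m+k} (E_{j+m} − E_j)/j]`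
for all `m ≥ m₀` and `k ≥ C₃ m`. -/
theorem stmt16 (C₀ C₁ : ℝ) (hC₀ : 0 < C₀) (hC₁ : 0 < C₁) :
    ∃ C₂ > (0 : ℝ), ∃ C₃ > (0 : ℝ), ∃ m₀ : ℕ, 1 ≤ m₀ ∧
      ∀ n : ℕ, 1 ≤ n → ∀ E : ℕ → ℝ, Monotone E → (∀ k, 0 ≤ E k) →
      (∀ k, E k ≤ C₀ * (n : ℝ) ^ 2) →
      (∀ m k : ℕ, 1 ≤ m → m ≤ k →
        E k ≤ C₁ * ((k : ℝ) ^ 2 + (E (k + m + 1) - E k)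
          + ((k : ℝ) ^ 4 / (m : ℝ) ^ 5) * tailSup E m (m + k))) →
      ∀ m k : ℕ, m₀ ≤ m → C₃ * (m : ℝ) ≤ (k : ℝ) →
        E k ≤ C₂ * ((k : ℝ) ^ 2 + (m : ℝ) ^ 3
          + ((k : ℝ) ^ 4 / (m : ℝ) ^ 5) * tailSup E m (m + k)) := by
  set θ : ℝ := C₁ / (1 + C₁) with hθ
  have hθ0 : 0 ≤ θ := by positivity
  have hθ1 : θ < 1 := by rw [hθ, div_lt_one (by positivity)]; linarith
  set K : ℝ := ∑' i : ℕ, (i : ℝ) ^ 4 * θ ^ i with hK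
  have hK0 : 0 ≤ K := tsum_nonneg fun i => mul_nonneg (by positivity) (pow_nonneg hθ0 i)
  refine ⟨16 * K + 1, by positivity, 1, one_pos, 1, le_rfl, ?_⟩
  intro n _ E hE hE0 hB hrec m k hm hmk
  rw [one_mul] at hmk
  have hmk' : m ≤ k := by exact_mod_cast hmk
  have hm1 : (1 : ℝ) ≤ m := by exact_mod_cast hm
  set S := tailSup E m (m + k) with hS
  have hS0 : 0 ≤ S := tailSup_nonneg hE m _
  have hT0 : 0 ≤ (k : ℝ) ^ 4 / (m : ℝ) ^ 5 * S := by positivity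
  have key : E (k + 0 * (m + 1)) ≤ 16 * ((k : ℝ) ^ 2 + (k : ℝ) ^ 4 / (m : ℝ) ^ 5 * S) * K := by
    refine le_tsum_of_backward_contraction (a := fun i => E (k + i * (m + 1))) hθ0 hθ1
      (by positivity) (fun i => hB _) fun i => ?_
    set q := k + i * (m + 1) with hq
    have hkq : k ≤ q := Nat.le_add_right _ _
    have hr := hrec m q hm (hmk'.trans hkq)
    have hidx : k + (i + 1) * (m + 1) = q + m + 1 := by rw [hq]; ring
    have hSq : tailSup E m (m + q) ≤ S := tailSup_anti hE0 hB m (by lia)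
    have hSq0 : 0 ≤ tailSup E m (m + q) := tailSup_nonneg hE m _
    have hi : (1 : ℝ) ≤ (i : ℝ) + 1 := by linarith [Nat.cast_nonneg (α := ℝ) i]
    have hqb : (q : ℝ) ≤ 2 * k * ((i : ℝ) + 1) := by
      rw [hq]
      push_cast
      nlinarith [Nat.cast_nonneg (α := ℝ) i]
    have h2 : (q : ℝ) ^ 2 ≤ 16 * (k : ℝ) ^ 2 * ((i : ℝ) + 1) ^ 4 := calc
      (q : ℝ) ^ 2 ≤ (2 * k * ((i : ℝ) + 1)) ^ 2 := by gcongr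
      _ = 4 * (k : ℝ) ^ 2 * ((i : ℝ) + 1) ^ 2 := by ring
      _ ≤ 16 * (k : ℝ) ^ 2 * ((i : ℝ) + 1) ^ 4 := by
        gcongr <;> norm_num
    have h4 : (q : ℝ) ^ 4 / (m : ℝ) ^ 5 * tailSup E m (m + q) ≤
        16 * ((k : ℝ) ^ 4 / (m : ℝ) ^ 5 * S) * ((i : ℝ) + 1) ^ 4 := calc
      _ ≤ (2 * k * ((i : ℝ) + 1)) ^ 4 / (m : ℝ) ^ 5 * S := by gcongr
      _ = _ := by ring
    simp only [hidx]
    rw [hθ, div_mul_eq_mul_div, le_div_iff₀ (by positivity)]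
    have := mul_le_mul_of_nonneg_left (add_le_add h2 h4) hC₁.le
    linarith
  rw [zero_mul, add_zero] at key
  have hm3 : (0 : ℝ) ≤ (m : ℝ) ^ 3 := by positivity
  have hk2 : (0 : ℝ) ≤ (k : ℝ) ^ 2 := by positivity
  nlinarith [mul_nonneg hK0 hm3]
end

section
/- Let θ ∈ (0, 1). There exists a constant C > 0, depending only on θ, with the following property. For every B ≥ 0, every natural number m ≥ 1, every nondecreasing sequence (E_k)_{k≥1} of nonnegative real numbers with E_k ≤ B k² for all k ≥ 1, and every S ≥ 0 such that E_{j+m} − E_j ≤ j S for all natural numbers j ≥ 2m: if E_k ≤ θ E_{k+m+1} + θ (k⁴/m⁵) S for all natural numbers k ≥ m, then E_m ≤ C S/m. -/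
open Filter Topology

/-- Iterating `E k ≤ θ E (k + d) + θ a k` along the progression `k + i d`. -/
theorem le_pow_mul_add_sum_of_le_mul_add {E a : ℕ → ℝ} {θ : ℝ} (hθ : 0 ≤ θ) {m d : ℕ}
    (h : ∀ k, m ≤ k → E k ≤ θ * E (k + d) + θ * a k) (r : ℕ) :
    E m ≤ θ ^ r * E (m + r * d) + ∑ i ∈ Finset.range r, θ ^ (i + 1) * a (m + i * d) := by
  induction r with
  | zero => simp
  | succ r ih =>
    have hstep := mul_le_mul_of_nonneg_left (h (m + r * d) (Nat.le_add_right _ _))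
      (pow_nonneg hθ r)
    rw [show m + r * d + d = m + (r + 1) * d by ring] at hstep
    rw [Finset.sum_range_succ]
    linear_combination ih + hstep

/-- Discrete iteration underlying the uniqueness proof: if a nondecreasing,
nonnegative sequence `(E_k)_{k≥1}` grows at most quadratically, has controlled
increments `E_{j+m} − E_j ≤ j S` for `j ≥ 2m`, and satisfies
`E_k ≤ θ E_{k+m+1} + θ (k⁴/m⁵) S` for `k ≥ m`, then `E_m ≤ C S / m`. -/
theorem stmt17 (θ : ℝ) (hθ0 : 0 < θ) (hθ1 : θ < 1) :
    ∃ C > (0 : ℝ), ∀ (B : ℝ), 0 ≤ B → ∀ m : ℕ, 1 ≤ m →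
      ∀ E : ℕ → ℝ, (∀ k : ℕ, 1 ≤ k → E k ≤ E (k + 1)) → (∀ k, 1 ≤ k → 0 ≤ E k) →
      (∀ k : ℕ, 1 ≤ k → E k ≤ B * (k : ℝ) ^ 2) →
      ∀ S : ℝ, 0 ≤ S →
      (∀ j : ℕ, 2 * m ≤ j → E (j + m) - E j ≤ (j : ℝ) * S) →
      (∀ k : ℕ, m ≤ k → E k ≤ θ * E (k + m + 1) + θ * ((k : ℝ) ^ 4 / (m : ℝ) ^ 5) * S) →
      E m ≤ C * S / (m : ℝ) := by
  have hsum : Summable fun i : ℕ => ((i + 1 : ℕ) : ℝ) ^ 4 * θ ^ (i + 1) :=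
    (summable_nat_add_iff (f := fun n : ℕ => (n : ℝ) ^ 4 * θ ^ n) 1).2
      (summable_pow_mul_geometric_of_norm_lt_one 4 (by rwa [Real.norm_of_nonneg hθ0.le]))
  set T : ℝ := ∑' i : ℕ, ((i + 1 : ℕ) : ℝ) ^ 4 * θ ^ (i + 1)
  have hT : 0 ≤ T := tsum_nonneg fun i => by positivity
  refine ⟨16 * T + 1, by positivity, ?_⟩
  intro B hB m hm E _ _ hquad S hS _ hrec
  have hm1 : (1 : ℝ) ≤ m := by exact_mod_cast hm
  have hm0 : (0 : ℝ) < m := by linarith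
  have hindex (i : ℕ) : ((m + i * (m + 1) : ℕ) : ℝ) ≤ 2 * m * ((i + 1 : ℕ) : ℝ) := by
    push_cast
    have hi : (0 : ℝ) ≤ i := Nat.cast_nonneg i
    nlinarith [mul_nonneg hi (sub_nonneg.2 hm1)]
  have hbound (r : ℕ) :
      E m ≤ 4 * B * (m : ℝ) ^ 2 / θ * (((r + 1 : ℕ) : ℝ) ^ 2 * θ ^ (r + 1))
        + 16 * T * S / m := by
    have hiter := le_pow_mul_add_sum_of_le_mul_add
      (a := fun k => (k : ℝ) ^ 4 / (m : ℝ) ^ 5 * S) (d := m + 1) hθ0.le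
      (fun k hk => by simpa only [mul_assoc, add_assoc] using hrec k hk) r
    have hhead : θ ^ r * E (m + r * (m + 1)) ≤
        4 * B * (m : ℝ) ^ 2 / θ * (((r + 1 : ℕ) : ℝ) ^ 2 * θ ^ (r + 1)) := by
      calc
        _ ≤ θ ^ r * (B * ((m + r * (m + 1) : ℕ) : ℝ) ^ 2) := by
          gcongr
          exact hquad _ (by omega)
        _ ≤ θ ^ r * (B * (2 * m * ((r + 1 : ℕ) : ℝ)) ^ 2) := by
          gcongr
          exact hindex r
        _ = _ := by
          field_simp
          ring
    have htail : ∑ i ∈ Finset.range r,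
        θ ^ (i + 1) * (((m + i * (m + 1) : ℕ) : ℝ) ^ 4 / (m : ℝ) ^ 5 * S) ≤
          16 * T * S / m := by
      calc
        _ ≤ ∑ i ∈ Finset.range r,
            θ ^ (i + 1) * ((2 * m * ((i + 1 : ℕ) : ℝ)) ^ 4 / (m : ℝ) ^ 5 * S) := by
          gcongr with i _
          exact hindex i
        _ = 16 * S / m * ∑ i ∈ Finset.range r, ((i + 1 : ℕ) : ℝ) ^ 4 * θ ^ (i + 1) := by
          rw [Finset.mul_sum]
          refine Finset.sum_congr rfl fun i _ => ?_
          field_simp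
          ring
        _ ≤ 16 * S / m * T := by
          gcongr
          exact hsum.sum_le_tsum _ fun i _ => by positivity
        _ = _ := by ring
    exact hiter.trans (add_le_add hhead htail)
  have hlim : Tendsto
      (fun r : ℕ => 4 * B * (m : ℝ) ^ 2 / θ * (((r + 1 : ℕ) : ℝ) ^ 2 * θ ^ (r + 1))
        + 16 * T * S / m) atTop (𝓝 (16 * T * S / m)) := by
    have h := (tendsto_pow_const_mul_const_pow_of_abs_lt_one 2
      (by rwa [abs_of_pos hθ0] : |θ| < 1)).comp (tendsto_add_atTop_nat 1)
    simpa using (h.const_mul (4 * B * (m : ℝ) ^ 2 / θ)).add_const (16 * T * S / m)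
  refine (ge_of_tendsto' hlim hbound).trans ?_
  gcongr
  linarith
end

section
/- There exists an absolute constant C > 0 with the following property. Let k ≥ m ≥ 2 be integers, let S ≥ 0, and let v : ℝ² → ℝ be a measurable function such that v = 0 almost everywhere on Σ_{k+m} and such that ∫_{Σ_{k+m(l+1)} \ Σ_{k+ml}} |v|² ≤ (k + ml) S for every integer l ≥ 1. Then ( ∫_{Σ_{k+1}} ( ∫_{ℝ²} |v(t)|/‖y−t‖³ dt )² dy )^{1/2} ≤ C (k^{3/2}/m²) S^{1/2}. -/
open MeasureTheory
open scoped ENNReal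

/-- The closed square `Σ_r = {x ∈ ℝ² : max(|x₁|, |x₂|) ≤ r}`. -/
def Sig (r : ℝ) : Set (EuclideanSpace ℝ (Fin 2)) :=
  {x | max |x 0| |x 1| ≤ r}

theorem measurableSet_Sig (r : ℝ) : MeasurableSet (Sig r) := by
  unfold Sig
  exact measurableSet_le (by fun_prop) measurable_const

/-- Points of `Sig r` and of the complement of `Sig s` are at distance at least `s - r`. -/
theorem sub_le_norm_sub_of_mem_Sig {r s : ℝ} {y t : EuclideanSpace ℝ (Fin 2)}
    (hy : y ∈ Sig r) (ht : t ∉ Sig s) : s - r ≤ ‖y - t‖ := by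
  have h0 := PiLp.norm_apply_le (y - t) 0
  have h1 := PiLp.norm_apply_le (y - t) 1
  simp only [PiLp.sub_apply, Real.norm_eq_abs] at h0 h1
  simp only [Sig, Set.mem_ofPred_eq, max_le_iff] at hy ht
  have a0 := abs_sub_abs_le_abs_sub (t 0) (y 0)
  have a1 := abs_sub_abs_le_abs_sub (t 1) (y 1)
  rw [abs_sub_comm] at a0 a1
  by_contra! h
  exact ht ⟨by linarith, by linarith⟩

theorem volume_Sig_le {r : ℝ} (hr : 0 ≤ r) :
    volume (Sig r) ≤ ENNReal.ofReal
      ((2 * r) ^ 2 * (volume (Metric.ball (0 : EuclideanSpace ℝ (Fin 2)) 1)).toReal) := by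
  have hsub : Sig r ⊆ Metric.closedBall 0 (2 * r) := by
    intro x hx
    simp only [Sig, Set.mem_ofPred_eq, max_le_iff] at hx
    rw [mem_closedBall_zero_iff, EuclideanSpace.norm_eq, Fin.sum_univ_two]
    refine Real.sqrt_le_iff.2 ⟨by positivity, ?_⟩
    simp only [Real.norm_eq_abs]
    nlinarith [abs_nonneg (x 0), abs_nonneg (x 1)]
  refine (measure_mono hsub).trans ?_
  rw [Measure.addHaar_closedBall _ _ (by positivity), ENNReal.ofReal_mul (by positivity),
    ENNReal.ofReal_toReal measure_ball_lt_top.ne]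
  simp

/-- The kernel `‖x‖⁻³` has integral `O(1/R)` outside the ball of radius `R` of the plane. -/
theorem exists_lintegral_inv_norm_cube_le :
    ∃ J : ℝ, 0 ≤ J ∧ ∀ R : ℝ, 0 < R → ∀ y : EuclideanSpace ℝ (Fin 2),
      ∫⁻ t in {t | R ≤ ‖y - t‖}, (ENNReal.ofReal (‖y - t‖ ^ 3))⁻¹ ≤ ENNReal.ofReal (J / R) := by
  set G : EuclideanSpace ℝ (Fin 2) → ℝ≥0∞ :=
    fun x => ENNReal.ofReal ((1 + ‖x‖) ^ (-(3 : ℝ))) with hG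
  have hGm : Measurable G := by fun_prop
  have hGfin : ∫⁻ x, G x < ∞ := finite_integral_one_add_norm (by simp; norm_num)
  refine ⟨8 * (∫⁻ x, G x).toReal, by positivity, fun R hR y => ?_⟩
  have hset : MeasurableSet {t : EuclideanSpace ℝ (Fin 2) | R ≤ ‖y - t‖} :=
    measurableSet_le measurable_const (by fun_prop)
  have hscale : ∫⁻ x, G (R⁻¹ • x) = ENNReal.ofReal (R ^ 2) * ∫⁻ x, G x := by
    rw [← lintegral_map (f := G) (g := fun x => R⁻¹ • x) hGm (by fun_prop),
      Measure.map_addHaar_smul _ (inv_ne_zero hR.ne'), lintegral_smul_measure]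
    simp
  calc ∫⁻ t in {t | R ≤ ‖y - t‖}, (ENNReal.ofReal (‖y - t‖ ^ 3))⁻¹
      ≤ ∫⁻ t in {t | R ≤ ‖y - t‖}, ENNReal.ofReal (8 / R ^ 3) * G (R⁻¹ • (y - t)) := by
        refine setLIntegral_mono (by fun_prop) fun t (ht : R ≤ ‖y - t‖) => ?_
        have hn : 0 < ‖y - t‖ := hR.trans_le ht
        rw [← ENNReal.ofReal_inv_of_pos (by positivity), hG,
          ← ENNReal.ofReal_mul (by positivity)]
        refine ENNReal.ofReal_le_ofReal ?_
        rw [norm_smul, Real.norm_of_nonneg (by positivity),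
          Real.rpow_neg (by positivity), ← div_eq_mul_inv, div_div]
        norm_cast
        rw [← mul_pow, inv_eq_one_div, div_le_div_iff₀ (by positivity) (by positivity)]
        have : R * (1 + R⁻¹ * ‖y - t‖) = R + ‖y - t‖ := by field_simp
        rw [this]
        calc 1 * (R + ‖y - t‖) ^ 3 ≤ 1 * (2 * ‖y - t‖) ^ 3 := by gcongr; linarith
          _ = 8 * ‖y - t‖ ^ 3 := by ring
    _ ≤ ∫⁻ t, ENNReal.ofReal (8 / R ^ 3) * G (R⁻¹ • (y - t)) := setLIntegral_le_lintegral _ _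
    _ = ∫⁻ t, ENNReal.ofReal (8 / R ^ 3) * G (R⁻¹ • t) :=
        lintegral_sub_left_eq_self (fun t => ENNReal.ofReal (8 / R ^ 3) * G (R⁻¹ • t)) y
    _ = ENNReal.ofReal (8 * (∫⁻ x, G x).toReal / R) := by
        rw [lintegral_const_mul _ (by fun_prop), hscale, ← ENNReal.ofReal_toReal hGfin.ne,
          ← ENNReal.ofReal_mul (by positivity), ← ENNReal.ofReal_mul (by positivity),
          ENNReal.toReal_ofReal (by positivity)]
        congr 1
        field_simp

/-- Cauchy–Schwarz for a function integrated against a weight. -/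
theorem sq_lintegral_abs_mul_le {α : Type*} [MeasurableSpace α] {μ : Measure α}
    {v : α → ℝ} {w : α → ℝ≥0∞} (hv : Measurable v) (hw : Measurable w) :
    (∫⁻ t, ENNReal.ofReal |v t| * w t ∂μ) ^ 2
      ≤ (∫⁻ t, ENNReal.ofReal (v t ^ 2) * w t ∂μ) * ∫⁻ t, w t ∂μ := by
  have h := ENNReal.lintegral_mul_norm_pow_le (μ := μ)
    (f := fun t => ENNReal.ofReal (v t ^ 2) * w t) (g := w)
    (by fun_prop) hw.aemeasurable (p := 1 / 2) (q := 1 / 2)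
    (by norm_num) (by norm_num) (by norm_num)
  have hpt : ∀ t, (ENNReal.ofReal (v t ^ 2) * w t) ^ (1 / 2 : ℝ) * w t ^ (1 / 2 : ℝ)
      = ENNReal.ofReal |v t| * w t := by
    intro t
    rw [ENNReal.mul_rpow_of_nonneg _ _ (by norm_num), mul_assoc,
      ← ENNReal.rpow_add_of_nonneg _ _ (by norm_num) (by norm_num),
      ENNReal.ofReal_rpow_of_nonneg (by positivity) (by norm_num), ← Real.sqrt_eq_rpow,
      Real.sqrt_sq_eq_abs]
    norm_num
  simp only [hpt] at h
  rw [← ENNReal.mul_rpow_of_nonneg _ _ (by norm_num)] at h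
  calc _ ≤ _ := pow_le_pow_left' h 2
    _ = _ := by rw [← ENNReal.rpow_natCast, ← ENNReal.rpow_mul]; norm_num

/-- The complement of the square `Sig (k + m)` is covered by the square annuli of width `m`. -/
theorem compl_Sig_subset_iUnion {k m : ℝ} (hm : 0 < m) :
    (Sig (k + m))ᶜ ⊆
      ⋃ l : ℕ, Sig (k + m * ((l + 1 : ℕ) + 1)) \ Sig (k + m * (l + 1 : ℕ)) := by
  intro x hx
  have hex : ∃ n : ℕ, x ∈ Sig (k + m * (n + 1)) := by
    obtain ⟨n, hn⟩ := exists_nat_ge ((max |x 0| |x 1| - k) / m)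
    refine ⟨n, ?_⟩
    rw [div_le_iff₀ hm] at hn
    change max |x 0| |x 1| ≤ _
    nlinarith
  classical
  obtain ⟨n, hn, hmin⟩ : ∃ n : ℕ, x ∈ Sig (k + m * (n + 1)) ∧
      ∀ j < n, x ∉ Sig (k + m * (j + 1)) :=
    ⟨Nat.find hex, Nat.find_spec hex, fun j hj => Nat.find_min hex hj⟩
  cases n with
  | zero => exact absurd hn (by simpa using hx)
  | succ l =>
    refine Set.mem_iUnion.2 ⟨l, hn, ?_⟩
    have := hmin l (Nat.lt_succ_self l)
    push_cast
    exact this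

/-- Weighted mass of a function with linearly growing annulus masses, against the kernel
`‖y - ·‖⁻³` centred at a point of the inner square. -/
theorem lintegral_compl_Sig_sq_mul_inv_norm_cube_le {k m S : ℝ} (hm : 2 ≤ m) (hmk : m ≤ k)
    (hS : 0 ≤ S) {v : EuclideanSpace ℝ (Fin 2) → ℝ}
    (hv : ∀ l : ℕ, 1 ≤ l → ∫⁻ x in Sig (k + m * (l + 1)) \ Sig (k + m * l),
      ENNReal.ofReal (v x ^ 2) ≤ ENNReal.ofReal ((k + m * l) * S))
    {y : EuclideanSpace ℝ (Fin 2)} (hy : y ∈ Sig (k + 1)) :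
    ∫⁻ t in (Sig (k + m))ᶜ, ENNReal.ofReal (v t ^ 2) * (ENNReal.ofReal (‖y - t‖ ^ 3))⁻¹
      ≤ ENNReal.ofReal (16 * k * S / m ^ 3 * ∑' l : ℕ, 1 / ((l : ℝ) + 1) ^ 2) := by
  have hk : 0 < k := by linarith
  have hsum : Summable fun l : ℕ => 1 / ((l : ℝ) + 1) ^ 2 := by
    have := (summable_nat_add_iff 1).2 (Real.summable_one_div_nat_pow.2 (le_refl 2))
    simpa using this
  have hann : ∀ l : ℕ, ∫⁻ t in Sig (k + m * ((l + 1 : ℕ) + 1)) \ Sig (k + m * (l + 1 : ℕ)),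
      ENNReal.ofReal (v t ^ 2) * (ENNReal.ofReal (‖y - t‖ ^ 3))⁻¹
        ≤ ENNReal.ofReal (16 * k * S / m ^ 3 * (1 / ((l : ℝ) + 1) ^ 2)) := by
    intro l
    have hl : (0 : ℝ) ≤ l := l.cast_nonneg
    calc _ ≤ ∫⁻ t in Sig (k + m * ((l + 1 : ℕ) + 1)) \ Sig (k + m * (l + 1 : ℕ)),
          ENNReal.ofReal (v t ^ 2) * ENNReal.ofReal ((m * (l + 1) / 2) ^ 3)⁻¹ := by
            refine setLIntegral_mono' ((measurableSet_Sig _).diff (measurableSet_Sig _))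
              fun t ht => ?_
            have hd := sub_le_norm_sub_of_mem_Sig hy ht.2
            push_cast at hd
            rw [ENNReal.ofReal_inv_of_pos (by positivity)]
            gcongr
            nlinarith
      _ = (∫⁻ t in Sig (k + m * ((l + 1 : ℕ) + 1)) \ Sig (k + m * (l + 1 : ℕ)),
          ENNReal.ofReal (v t ^ 2)) * ENNReal.ofReal ((m * (l + 1) / 2) ^ 3)⁻¹ :=
            lintegral_mul_const' _ _ ENNReal.ofReal_ne_top
      _ ≤ ENNReal.ofReal ((k + m * (l + 1 : ℕ)) * S) *
            ENNReal.ofReal ((m * (l + 1) / 2) ^ 3)⁻¹ := by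
            gcongr
            exact hv (l + 1) (by omega)
      _ ≤ _ := by
            rw [← ENNReal.ofReal_mul (by positivity)]
            refine ENNReal.ofReal_le_ofReal ?_
            have h1 : (k + m * (l + 1 : ℕ)) ≤ 2 * k * (l + 1) := by
              push_cast
              nlinarith
            calc _ ≤ 2 * k * (l + 1) * S * ((m * (l + 1) / 2) ^ 3)⁻¹ := by gcongr
              _ = _ := by field_simp; ring
  calc _ ≤ ∫⁻ t in ⋃ l : ℕ, Sig (k + m * ((l + 1 : ℕ) + 1)) \ Sig (k + m * (l + 1 : ℕ)),
        ENNReal.ofReal (v t ^ 2) * (ENNReal.ofReal (‖y - t‖ ^ 3))⁻¹ :=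
        lintegral_mono_set (compl_Sig_subset_iUnion (by linarith))
    _ ≤ _ := lintegral_iUnion_le _ _
    _ ≤ ∑' l : ℕ, ENNReal.ofReal (16 * k * S / m ^ 3 * (1 / ((l : ℝ) + 1) ^ 2)) :=
        ENNReal.tsum_le_tsum hann
    _ = _ := by
        rw [← ENNReal.ofReal_tsum_of_nonneg (fun l => by positivity) (hsum.mul_left _),
          tsum_mul_left]

/-- Large-scale estimate for kernels decaying like `‖x‖⁻³`: if `v` vanishes on
`Σ_{k+m}` and `∫_{Σ_{k+m(l+1)}∖Σ_{k+ml}} |v|² ≤ (k+ml) S`, then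
`‖ v ∗ ‖·‖⁻³ ‖_{L²(Σ_{k+1})} ≤ C (k^{3/2}/m²) S^{1/2}`. -/
theorem stmt18 :
    ∃ C > (0 : ℝ), ∀ k m : ℕ, 2 ≤ m → m ≤ k → ∀ S : ℝ, 0 ≤ S →
      ∀ v : EuclideanSpace ℝ (Fin 2) → ℝ, Measurable v →
      (∀ᵐ x, x ∈ Sig ((k : ℝ) + m) → v x = 0) →
      (∀ l : ℕ, 1 ≤ l →
        ∫⁻ x in Sig ((k : ℝ) + m * (l + 1)) \ Sig ((k : ℝ) + m * l),
          ENNReal.ofReal (v x ^ 2) ≤ ENNReal.ofReal (((k : ℝ) + m * l) * S)) →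
      (∫⁻ y in Sig ((k : ℝ) + 1),
          (∫⁻ t, ENNReal.ofReal |v t| / ENNReal.ofReal (‖y - t‖ ^ 3)) ^ 2) ^ ((1 : ℝ) / 2)
        ≤ ENNReal.ofReal (C * (k : ℝ) ^ ((3 : ℝ) / 2) / (m : ℝ) ^ 2 * Real.sqrt S) := by
  obtain ⟨J, hJ, hker⟩ := exists_lintegral_inv_norm_cube_le
  set T : ℝ := ∑' l : ℕ, 1 / ((l : ℝ) + 1) ^ 2
  have hT : 0 ≤ T := tsum_nonneg fun l => by positivity
  set V : ℝ := (volume (Metric.ball (0 : EuclideanSpace ℝ (Fin 2)) 1)).toReal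
  have hV : 0 ≤ V := ENNReal.toReal_nonneg
  refine ⟨√(512 * T * J * V) + 1, by positivity, fun k m hm hmk S hS v hv hv0 hann => ?_⟩
  have hm' : (2 : ℝ) ≤ m := by exact_mod_cast hm
  have hmk' : (m : ℝ) ≤ k := by exact_mod_cast hmk
  have hk : (0 : ℝ) < k := by linarith
  have hpt : ∀ y ∈ Sig ((k : ℝ) + 1),
      (∫⁻ t, ENNReal.ofReal |v t| / ENNReal.ofReal (‖y - t‖ ^ 3)) ^ 2
        ≤ ENNReal.ofReal (32 * k * S * T * J / m ^ 4) := by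
    intro y hy
    have hrestr : ∫⁻ t, ENNReal.ofReal |v t| / ENNReal.ofReal (‖y - t‖ ^ 3)
        = ∫⁻ t in (Sig ((k : ℝ) + m))ᶜ,
          ENNReal.ofReal |v t| * (ENNReal.ofReal (‖y - t‖ ^ 3))⁻¹ := by
      rw [← lintegral_indicator (measurableSet_Sig _).compl]
      refine lintegral_congr_ae ?_
      filter_upwards [hv0] with t ht
      by_cases h : t ∈ Sig ((k : ℝ) + m)
      · simp [h, ht h]
      · simp [h, div_eq_mul_inv]
    have htail : ∫⁻ t in (Sig ((k : ℝ) + m))ᶜ, (ENNReal.ofReal (‖y - t‖ ^ 3))⁻¹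
        ≤ ENNReal.ofReal (J / (m / 2)) := by
      refine (lintegral_mono_set fun t ht => ?_).trans (hker _ (by positivity) y)
      have := sub_le_norm_sub_of_mem_Sig hy ht
      change (m : ℝ) / 2 ≤ _
      linarith
    rw [hrestr]
    refine (sq_lintegral_abs_mul_le hv (by fun_prop)).trans
      ((mul_le_mul' (lintegral_compl_Sig_sq_mul_inv_norm_cube_le hm' hmk' hS hann hy)
        htail).trans_eq ?_)
    rw [← ENNReal.ofReal_mul (by positivity)]
    congr 1
    change 16 * k * S / m ^ 3 * T * (J / (m / 2)) = _
    field_simp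
    ring
  have hint : ∫⁻ y in Sig ((k : ℝ) + 1),
      (∫⁻ t, ENNReal.ofReal |v t| / ENNReal.ofReal (‖y - t‖ ^ 3)) ^ 2
        ≤ ENNReal.ofReal (512 * T * J * V * (k ^ 3 / m ^ 4 * S)) := by
    refine (setLIntegral_mono' (measurableSet_Sig _) hpt).trans ?_
    rw [setLIntegral_const]
    refine (mul_le_mul_right (volume_Sig_le (by positivity)) _).trans ?_
    rw [← ENNReal.ofReal_mul (by positivity)]
    refine ENNReal.ofReal_le_ofReal ?_
    calc _ ≤ 32 * k * S * T * J / m ^ 4 * ((2 * (k + k)) ^ 2 * V) := by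
          gcongr
          linarith
      _ = _ := by ring
  refine (ENNReal.rpow_le_rpow hint (by norm_num)).trans ?_
  rw [ENNReal.ofReal_rpow_of_nonneg (by positivity) (by norm_num), ← Real.sqrt_eq_rpow]
  refine ENNReal.ofReal_le_ofReal ?_
  have hroot : √((k : ℝ) ^ 3 / m ^ 4 * S) = (k : ℝ) ^ ((3 : ℝ) / 2) / m ^ 2 * √S := by
    rw [Real.sqrt_mul (by positivity), Real.sqrt_div (by positivity)]
    congr 2
    · rw [Real.sqrt_eq_rpow, ← Real.rpow_natCast, ← Real.rpow_mul hk.le]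
      norm_num
    · rw [show (m : ℝ) ^ 4 = (m ^ 2) ^ 2 by ring, Real.sqrt_sq (by positivity)]
  rw [Real.sqrt_mul (by positivity), hroot, mul_div_assoc, mul_assoc _ _ (√S)]
  gcongr
  linarith
end
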